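/- arXiv:2210.00659 — 3 statements merged into one kernel-verified Lean document; each statement's English description precedes it below -/
import Mathlib

section
/- Let τ lie in the complex upper half-plane and set x = u(τ), y = u(2τ). Then x⁴·(y⁴ + 1) = 2·y². -/
/-- `qpow τ r = exp(2πi·r·τ)`, i.e. `q^r` where `q = exp(2πiτ)`. -/
noncomputable def qpow (τ : ℂ) (r : ℝ) : ℂ :=
  Complex.exp (2 * (Real.pi : ℂ) * Complex.I * (r : ℂ) * τ)

/-- `u(τ) = √2 · q^{1/8} ∏_{n≥1} (1 + q^n)^{(-1)^n}`, `q = exp(2πiτ)`. -/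
noncomputable def uRam (τ : ℂ) : ℂ :=
  (Real.sqrt 2 : ℂ) * qpow τ (1/8) *
    ∏' n : ℕ, (1 + qpow τ ((n : ℝ) + 1)) ^ ((-1 : ℤ) ^ (n + 1))

open Filter Topology

/-- The finite `q`-Pochhammer symbol `(p; p)_n`. -/
noncomputable def qPoch (p : ℂ) (n : ℕ) : ℂ :=
  ∏ k ∈ Finset.range n, (1 - p ^ (k + 1))

/-- The reciprocal `1 / (p; p)_m`, extended by zero to negative `m`. -/
noncomputable def qPochInv (p : ℂ) (m : ℤ) : ℂ :=
  if m < 0 then 0 else (qPoch p m.toNat)⁻¹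

lemma norm_sq_lt_one {q : ℂ} (hq : ‖q‖ < 1) : ‖q ^ 2‖ < 1 := by
  rw [norm_pow]; exact pow_lt_one₀ (norm_nonneg q) hq two_ne_zero

lemma one_sub_pow_succ_ne_zero {p : ℂ} (hp : ‖p‖ < 1) (k : ℕ) : 1 - p ^ (k + 1) ≠ 0 := by
  intro h
  have h1 : ‖p ^ (k + 1)‖ = 1 := by rw [← sub_eq_zero.mp h, norm_one]
  rw [norm_pow] at h1
  exact (pow_lt_one₀ (norm_nonneg p) hp k.succ_ne_zero).ne h1

lemma one_add_pow_succ_ne_zero {p : ℂ} (hp : ‖p‖ < 1) (k : ℕ) : 1 + p ^ (k + 1) ≠ 0 := by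
  intro h
  have h1 : ‖p ^ (k + 1)‖ = 1 := by
    rw [eq_neg_of_add_eq_zero_right h, norm_neg, norm_one]
  rw [norm_pow] at h1
  exact (pow_lt_one₀ (norm_nonneg p) hp k.succ_ne_zero).ne h1

lemma qPoch_ne_zero {p : ℂ} (hp : ‖p‖ < 1) (n : ℕ) : qPoch p n ≠ 0 :=
  Finset.prod_ne_zero_iff.mpr fun k _ => one_sub_pow_succ_ne_zero hp k

lemma qPochInv_natCast (p : ℂ) (n : ℕ) : qPochInv p n = (qPoch p n)⁻¹ := by
  simp [qPochInv]

lemma qPochInv_of_neg (p : ℂ) {m : ℤ} (hm : m < 0) : qPochInv p m = 0 := if_pos hm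

lemma qPochInv_sub_one {p : ℂ} (hp : ‖p‖ < 1) (m : ℤ) :
    qPochInv p (m - 1) = (1 - p ^ m) * qPochInv p m := by
  rcases lt_trichotomy m 0 with hm | rfl | hm
  · rw [qPochInv_of_neg p hm, qPochInv_of_neg p (by omega), mul_zero]
  · rw [qPochInv_of_neg p (by omega)]
    simp
  · obtain ⟨k, rfl⟩ : ∃ k : ℕ, m = ((k + 1 : ℕ) : ℤ) := ⟨(m - 1).toNat, by omega⟩
    have h1 : (((k + 1 : ℕ) : ℤ) - 1) = (k : ℤ) := by push_cast; ring
    have h2 := one_sub_pow_succ_ne_zero hp k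
    have h3 := qPoch_ne_zero hp k
    rw [h1, qPochInv_natCast, qPochInv_natCast, zpow_natCast, qPoch, qPoch,
      Finset.prod_range_succ, mul_inv, mul_comm, mul_assoc, inv_mul_cancel₀ h2, mul_one]

/-- The Gaussian binomial coefficient `[2n, n + j]_p`. -/
noncomputable def centralQBinom (p : ℂ) (n : ℕ) (j : ℤ) : ℂ :=
  qPoch p (2 * n) * (qPochInv p (n + j) * qPochInv p (n - j))

lemma centralQBinom_succ {q : ℂ} (h0 : q ≠ 0) (hq : ‖q‖ < 1) (n : ℕ) (j : ℤ) :
    centralQBinom (q ^ 2) (n + 1) j =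
      (1 + (q ^ (2 * n + 1)) ^ 2) * centralQBinom (q ^ 2) n j
      + (q ^ 2) ^ (n + 1 - j : ℤ) * centralQBinom (q ^ 2) n (j - 1)
      + (q ^ 2) ^ (n + 1 + j : ℤ) * centralQBinom (q ^ 2) n (j + 1) := by
  have hp := norm_sq_lt_one hq
  have hp0 : q ^ 2 ≠ 0 := pow_ne_zero 2 h0
  have e1 := qPochInv_sub_one hp (n + 1 + j)
  have e2 := qPochInv_sub_one hp (n + 1 - j)
  have e3 := qPochInv_sub_one hp (n + j)
  have e4 := qPochInv_sub_one hp (n - j)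
  rw [show (n + 1 + j - 1 : ℤ) = n + j by ring] at e1
  rw [show (n + 1 - j - 1 : ℤ) = n - j by ring] at e2
  have ha : (q ^ 2) ^ (n + 1 + j : ℤ) = (q ^ 2) ^ (n + j : ℤ) * q ^ 2 := by
    rw [← zpow_add_one₀ hp0]; congr 1; ring
  have hb : (q ^ 2) ^ (n + 1 - j : ℤ) = (q ^ 2) ^ (n - j : ℤ) * q ^ 2 := by
    rw [← zpow_add_one₀ hp0]; congr 1; ring
  have hab : (q ^ 2) ^ (n + j : ℤ) * (q ^ 2) ^ (n - j : ℤ) = q ^ (4 * n) := by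
    rw [← zpow_add₀ hp0, show (n + j + (n - j) : ℤ) = ((2 * n : ℕ) : ℤ) by push_cast; ring,
      zpow_natCast, ← pow_mul]
    congr 1; ring
  have hP : qPoch (q ^ 2) (2 * (n + 1)) =
      qPoch (q ^ 2) (2 * n) * (1 - q ^ (4 * n) * q ^ 2) * (1 - q ^ (4 * n) * q ^ 4) := by
    rw [qPoch, qPoch, show 2 * (n + 1) = 2 * n + 1 + 1 by ring, Finset.prod_range_succ,
      Finset.prod_range_succ]
    ring
  have hQ : (q ^ (2 * n + 1)) ^ 2 = q ^ (4 * n) * q ^ 2 := by ring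
  simp only [centralQBinom]
  rw [hP, hQ, ← hab]
  push_cast
  rw [show (n + (j - 1) : ℤ) = n + j - 1 by ring, show (n - (j - 1) : ℤ) = n + 1 - j by ring,
    show (n + (j + 1) : ℤ) = n + 1 + j by ring, show (n - (j + 1) : ℤ) = n - j - 1 by ring,
    e3, e4, e1, e2, ha, hb]
  ring

lemma hasSum_of_eq {ι : Type*} {f g : ι → ℂ} {a b : ℂ} (h : HasSum g b) (hfg : ∀ i, f i = g i)
    (hab : a = b) : HasSum f a := by
  rwa [funext hfg, hab]

lemma hasSum_centralQBinom {q z : ℂ} (h0 : q ≠ 0) (hq : ‖q‖ < 1) (hz : z ≠ 0) (n : ℕ) :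
    HasSum (fun j : ℤ => centralQBinom (q ^ 2) n j * (z ^ j * q ^ (j ^ 2)))
      (∏ k ∈ Finset.range n, ((1 + z * q ^ (2 * k + 1)) * (1 + z⁻¹ * q ^ (2 * k + 1)))) := by
  induction n with
  | zero =>
    convert hasSum_single (0 : ℤ) _ using 1
    · simp [centralQBinom, qPoch, qPochInv]
    · intro j hj
      rcases lt_or_gt_of_ne hj with h | h
      · simp [centralQBinom, qPochInv_of_neg _ h]
      · simp [centralQBinom, qPochInv_of_neg _ (neg_lt_zero.mpr h)]
  | succ n ih =>
    set Q := q ^ (2 * n + 1) with hQ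
    have s1 := (Equiv.subRight (1 : ℤ)).hasSum_iff.mpr ih
    have s2 := (Equiv.addRight (1 : ℤ)).hasSum_iff.mpr ih
    have key := ((ih.mul_left (1 + Q ^ 2)).add (s1.mul_left (Q * z))).add
      (s2.mul_left (Q * z⁻¹))
    rw [Finset.prod_range_succ]
    refine hasSum_of_eq key (fun j => ?_) ?_
    · have hQz : Q = q ^ (2 * n + 1 : ℤ) := by
        rw [hQ, ← zpow_natCast]; push_cast; rfl
      have z1 : z * z ^ (j - 1) = z ^ j := by
        rw [← zpow_one_add₀ hz]; congr 1; ring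
      have z2 : z⁻¹ * z ^ (j + 1) = z ^ j := by
        rw [zpow_add_one₀ hz]; field_simp
      have p1 : Q * q ^ ((j - 1) ^ 2) = (q ^ 2) ^ (n + 1 - j : ℤ) * q ^ (j ^ 2) := by
        rw [hQz, ← zpow_natCast q 2, ← zpow_mul, ← zpow_add₀ h0, ← zpow_add₀ h0]
        congr 1; push_cast; ring
      have p2 : Q * q ^ ((j + 1) ^ 2) = (q ^ 2) ^ (n + 1 + j : ℤ) * q ^ (j ^ 2) := by
        rw [hQz, ← zpow_natCast q 2, ← zpow_mul, ← zpow_add₀ h0, ← zpow_add₀ h0]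
        congr 1; push_cast; ring
      simp only [Function.comp_apply, Equiv.subRight_apply, Equiv.coe_addRight]
      rw [centralQBinom_succ h0 hq]
      linear_combination (-centralQBinom (q ^ 2) n (j - 1) * z ^ j) * p1
        + (-centralQBinom (q ^ 2) n (j + 1) * z ^ j) * p2
        - (Q * centralQBinom (q ^ 2) n (j - 1) * q ^ ((j - 1) ^ 2)) * z1
        - (Q * centralQBinom (q ^ 2) n (j + 1) * q ^ ((j + 1) ^ 2)) * z2
    · have : z * z⁻¹ = 1 := mul_inv_cancel₀ hz
      linear_combination (Q ^ 2 * ∏ k ∈ Finset.range n,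
        ((1 + z * q ^ (2 * k + 1)) * (1 + z⁻¹ * q ^ (2 * k + 1)))) * this

lemma summable_norm_pow_linear {q : ℂ} (hq : ‖q‖ < 1) (a b : ℕ) (ha : a ≠ 0) :
    Summable fun k : ℕ => ‖q ^ (a * k + b)‖ := by
  have h : Summable fun k : ℕ => (‖q‖ ^ a) ^ k * ‖q‖ ^ b :=
    (summable_geometric_of_lt_one (by positivity)
      (pow_lt_one₀ (norm_nonneg q) hq ha)).mul_right _
  refine h.congr fun k => ?_
  rw [norm_pow, pow_add, pow_mul]

lemma summable_norm_pow_succ {q : ℂ} (hq : ‖q‖ < 1) : Summable fun k : ℕ => ‖q ^ (k + 1)‖ := by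
  simpa using summable_norm_pow_linear hq 1 1 one_ne_zero

lemma multipliable_one_add_mul_pow {q : ℂ} (hq : ‖q‖ < 1) (z : ℂ) :
    Multipliable fun k : ℕ => 1 + z * q ^ (2 * k + 1) := by
  apply multipliable_one_add_of_summable
  simp_rw [norm_mul]
  exact (summable_norm_pow_linear hq 2 1 two_ne_zero).mul_left _

lemma multipliable_one_sub_pow_succ {p : ℂ} (hp : ‖p‖ < 1) :
    Multipliable fun k : ℕ => 1 - p ^ (k + 1) := by
  simp_rw [sub_eq_add_neg]
  apply multipliable_one_add_of_summable
  simpa only [norm_neg] using summable_norm_pow_succ hp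

lemma multipliable_one_add_pow_succ {p : ℂ} (hp : ‖p‖ < 1) :
    Multipliable fun k : ℕ => 1 + p ^ (k + 1) :=
  multipliable_one_add_of_summable (summable_norm_pow_succ hp)

lemma multipliable_one_add_pow_odd {q : ℂ} (hq : ‖q‖ < 1) :
    Multipliable fun k : ℕ => 1 + q ^ (2 * k + 1) :=
  multipliable_one_add_of_summable (summable_norm_pow_linear hq 2 1 two_ne_zero)

/-- The Euler product `∏_{n ≥ 1} (1 - p^n)`. -/
noncomputable def eulerProd (p : ℂ) : ℂ := ∏' k : ℕ, (1 - p ^ (k + 1))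

/-- The product `∏_{n ≥ 1} (1 + p^n)`. -/
noncomputable def plusProd (p : ℂ) : ℂ := ∏' k : ℕ, (1 + p ^ (k + 1))

/-- The product `∏_{n ≥ 1} (1 + q^{2n-1})`. -/
noncomputable def oddPlusProd (q : ℂ) : ℂ := ∏' k : ℕ, (1 + q ^ (2 * k + 1))

lemma eulerProd_ne_zero {p : ℂ} (hp : ‖p‖ < 1) : eulerProd p ≠ 0 := by
  simp_rw [eulerProd, sub_eq_add_neg]
  refine tprod_one_add_ne_zero_of_summable (fun k => ?_) ?_
  · rw [← sub_eq_add_neg]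
    exact one_sub_pow_succ_ne_zero hp k
  · simpa only [norm_neg] using summable_norm_pow_succ hp

lemma oddPlusProd_ne_zero {q : ℂ} (hq : ‖q‖ < 1) : oddPlusProd q ≠ 0 :=
  tprod_one_add_ne_zero_of_summable (fun k => one_add_pow_succ_ne_zero hq (2 * k))
    (summable_norm_pow_linear hq 2 1 two_ne_zero)

lemma oddPlusProd_mul_plusProd_sq {q : ℂ} (hq : ‖q‖ < 1) :
    oddPlusProd q * plusProd (q ^ 2) = plusProd q := by
  have hf : (fun k : ℕ => 1 + q ^ (2 * k + 1 + 1)) = fun k => 1 + (q ^ 2) ^ (k + 1) := by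
    funext k; rw [← pow_mul]; rfl
  have := tprod_even_mul_odd (f := fun k : ℕ => 1 + q ^ (k + 1))
    (multipliable_one_add_pow_odd hq)
    (hf ▸ multipliable_one_add_pow_succ (norm_sq_lt_one hq))
  rwa [hf] at this

lemma eulerProd_mul_plusProd {p : ℂ} (hp : ‖p‖ < 1) :
    eulerProd p * plusProd p = eulerProd (p ^ 2) := by
  rw [eulerProd, plusProd, ← (multipliable_one_sub_pow_succ hp).tprod_mul
    (multipliable_one_add_pow_succ hp), eulerProd]
  congr 1; funext k; ring

lemma tendsto_qPoch {p : ℂ} (hp : ‖p‖ < 1) :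
    Tendsto (qPoch p) atTop (𝓝 (eulerProd p)) :=
  (multipliable_one_sub_pow_succ hp).tendsto_prod_tprod_nat

lemma exists_norm_qPoch_le {p : ℂ} (hp : ‖p‖ < 1) : ∃ C, ∀ n, ‖qPoch p n‖ ≤ C := by
  obtain ⟨C, hC⟩ := (tendsto_qPoch hp).norm.bddAbove_range
  exact ⟨C, fun n => hC ⟨n, rfl⟩⟩

lemma exists_norm_qPochInv_le {p : ℂ} (hp : ‖p‖ < 1) : ∃ C, ∀ m, ‖qPochInv p m‖ ≤ C := by
  obtain ⟨C, hC⟩ := ((tendsto_qPoch hp).inv₀ (eulerProd_ne_zero hp)).norm.bddAbove_range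
  refine ⟨C, fun m => ?_⟩
  rcases lt_or_ge m 0 with hm | hm
  · rw [qPochInv_of_neg p hm, norm_zero]
    exact (norm_nonneg _).trans (hC ⟨0, rfl⟩)
  · lift m to ℕ using hm
    rw [qPochInv_natCast]
    exact hC ⟨m, rfl⟩

lemma tendsto_qPochInv {p : ℂ} (hp : ‖p‖ < 1) :
    Tendsto (qPochInv p) atTop (𝓝 (eulerProd p)⁻¹) := by
  have h : Tendsto (fun m : ℤ => (qPoch p m.toNat)⁻¹) atTop (𝓝 (eulerProd p)⁻¹) :=
    ((tendsto_qPoch hp).inv₀ (eulerProd_ne_zero hp)).comp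
      (tendsto_atTop_atTop.mpr fun b => ⟨b, fun a ha => by omega⟩)
  refine h.congr' ?_
  filter_upwards [eventually_ge_atTop 0] with m hm
  rw [qPochInv, if_neg hm.not_gt]

lemma tendsto_centralQBinom {p : ℂ} (hp : ‖p‖ < 1) (j : ℤ) :
    Tendsto (fun n => centralQBinom p n j) atTop (𝓝 (eulerProd p)⁻¹) := by
  have h1 : Tendsto (fun n : ℕ => qPoch p (2 * n)) atTop (𝓝 (eulerProd p)) :=
    (tendsto_qPoch hp).comp (tendsto_atTop_atTop.mpr fun b => ⟨b, fun a ha => by omega⟩)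
  have h2 : Tendsto (fun n : ℕ => qPochInv p (n + j)) atTop (𝓝 (eulerProd p)⁻¹) :=
    (tendsto_qPochInv hp).comp (tendsto_atTop_atTop.mpr
      fun b => ⟨(b - j).toNat, fun a ha => by omega⟩)
  have h3 : Tendsto (fun n : ℕ => qPochInv p (n - j)) atTop (𝓝 (eulerProd p)⁻¹) :=
    (tendsto_qPochInv hp).comp (tendsto_atTop_atTop.mpr
      fun b => ⟨(b + j).toNat, fun a ha => by omega⟩)
  have h := h1.mul (h2.mul h3)
  rwa [mul_inv_cancel_left₀ (eulerProd_ne_zero hp)] at h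

lemma exists_norm_centralQBinom_le {p : ℂ} (hp : ‖p‖ < 1) :
    ∃ C, ∀ n j, ‖centralQBinom p n j‖ ≤ C := by
  obtain ⟨C, hC⟩ := exists_norm_qPoch_le hp
  obtain ⟨D, hD⟩ := exists_norm_qPochInv_le hp
  refine ⟨C * (D * D), fun n j => ?_⟩
  have hC0 : 0 ≤ C := (norm_nonneg _).trans (hC 0)
  have hD0 : 0 ≤ D := (norm_nonneg _).trans (hD 0)
  rw [centralQBinom, norm_mul, norm_mul]
  gcongr
  exacts [hC _, hD _, hD _]

lemma summable_norm_zpow_mul_zpow_sq {q z : ℂ} (h0 : q ≠ 0) (hq : ‖q‖ < 1) (hz : z ≠ 0) :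
    Summable fun j : ℤ => ‖z ^ j * q ^ (j ^ 2)‖ := by
  have hI : (Real.pi : ℂ) * Complex.I ≠ 0 := by simp [Real.pi_ne_zero]
  have hτ : 0 < (Complex.log q / (Real.pi * Complex.I)).im := by
    have h1 : Complex.log q / (Real.pi * Complex.I) =
        -((Real.pi⁻¹ : ℝ) : ℂ) * Complex.log q * Complex.I := by
      rw [Complex.ofReal_inv]
      field_simp
      rw [Complex.I_sq]; ring
    rw [h1]
    have h2 : Real.log ‖q‖ < 0 := Real.log_neg (norm_pos_iff.mpr h0) hq
    have h3 : 0 < Real.pi⁻¹ := inv_pos.mpr Real.pi_pos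
    simp [-Complex.ofReal_inv, Complex.log_re]
    nlinarith
  refine ((summable_jacobiTheta₂_term_iff (Complex.log z / (2 * Real.pi * Complex.I)) _).mpr
    hτ).norm.congr fun j => ?_
  congr 1
  have h1 : z ^ j = Complex.exp (j * Complex.log z) := by
    rw [Complex.exp_int_mul, Complex.exp_log hz]
  have h2 : q ^ (j ^ 2) = Complex.exp ((j ^ 2 : ℤ) * Complex.log q) := by
    rw [Complex.exp_int_mul, Complex.exp_log h0]
  rw [h1, h2, ← Complex.exp_add, jacobiTheta₂_term]
  congr 1
  push_cast
  field_simp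

/-- The Jacobi triple product identity. -/
theorem tsum_zpow_mul_zpow_sq {q z : ℂ} (h0 : q ≠ 0) (hq : ‖q‖ < 1) (hz : z ≠ 0) :
    ∑' j : ℤ, z ^ j * q ^ (j ^ 2) = eulerProd (q ^ 2) *
      ((∏' k : ℕ, (1 + z * q ^ (2 * k + 1))) * ∏' k : ℕ, (1 + z⁻¹ * q ^ (2 * k + 1))) := by
  have hp := norm_sq_lt_one hq
  obtain ⟨C, hC⟩ := exists_norm_centralQBinom_le hp
  have h1 := tendsto_tsum_of_dominated_convergence
    (f := fun n j => centralQBinom (q ^ 2) n j * (z ^ j * q ^ (j ^ 2)))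
    ((summable_norm_zpow_mul_zpow_sq h0 hq hz).mul_left C)
    (fun j => (tendsto_centralQBinom hp j).mul_const _)
    (Eventually.of_forall fun n j => by
      rw [norm_mul]
      exact mul_le_mul_of_nonneg_right (hC n j) (norm_nonneg _))
  simp_rw [fun n => (hasSum_centralQBinom h0 hq hz n).tsum_eq, Finset.prod_mul_distrib] at h1
  have h2 := (multipliable_one_add_mul_pow hq z).tendsto_prod_tprod_nat.mul
    (multipliable_one_add_mul_pow hq z⁻¹).tendsto_prod_tprod_nat
  rw [tendsto_nhds_unique h2 h1, tsum_mul_left, mul_inv_cancel_left₀ (eulerProd_ne_zero hp)]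

/-- The theta series `∑ q^{j²}`. -/
noncomputable def thetaSq (q : ℂ) : ℂ := ∑' j : ℤ, q ^ (j ^ 2)

/-- The theta series `∑ q^{j² + j}`. -/
noncomputable def thetaPronic (q : ℂ) : ℂ := ∑' j : ℤ, q ^ (j ^ 2 + j)

lemma summable_norm_zpow_sq {q : ℂ} (h0 : q ≠ 0) (hq : ‖q‖ < 1) :
    Summable fun j : ℤ => ‖q ^ (j ^ 2)‖ := by
  simpa using summable_norm_zpow_mul_zpow_sq h0 hq one_ne_zero

lemma summable_norm_zpow_pronic {q : ℂ} (h0 : q ≠ 0) (hq : ‖q‖ < 1) :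
    Summable fun j : ℤ => ‖q ^ (j ^ 2 + j)‖ := by
  refine (summable_norm_zpow_mul_zpow_sq h0 hq h0).congr fun j => ?_
  rw [zpow_add₀ h0, mul_comm]

lemma thetaSq_eq_prod {q : ℂ} (h0 : q ≠ 0) (hq : ‖q‖ < 1) :
    thetaSq q = eulerProd (q ^ 2) * oddPlusProd q ^ 2 := by
  have := tsum_zpow_mul_zpow_sq h0 hq one_ne_zero
  simp only [one_zpow, one_mul, inv_one] at this
  rw [thetaSq, this, oddPlusProd, sq (∏' k : ℕ, _)]

lemma thetaPronic_eq_prod {q : ℂ} (h0 : q ≠ 0) (hq : ‖q‖ < 1) :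
    thetaPronic q = 2 * eulerProd (q ^ 2) * plusProd (q ^ 2) ^ 2 := by
  have h1 : ∀ k : ℕ, q * q ^ (2 * k + 1) = (q ^ 2) ^ (k + 1) := fun k => by ring
  have h2 : ∀ k : ℕ, q⁻¹ * q ^ (2 * k + 1) = (q ^ 2) ^ k := fun k => by
    rw [pow_succ', inv_mul_cancel_left₀ h0, pow_mul]
  have h3 : ∏' k : ℕ, (1 + (q ^ 2) ^ k) = 2 * plusProd (q ^ 2) := by
    have hp := norm_sq_lt_one hq
    generalize q ^ 2 = p at hp
    have h := tprod_eq_zero_mul' (f := fun k : ℕ => 1 + p ^ k)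
      (multipliable_one_add_pow_succ hp)
    rw [h, plusProd, pow_zero, one_add_one_eq_two]
  have h4 : thetaPronic q = ∑' j : ℤ, q ^ j * q ^ (j ^ 2) :=
    tsum_congr fun j => by rw [zpow_add₀ h0, mul_comm]
  rw [h4, tsum_zpow_mul_zpow_sq h0 hq h0]
  simp_rw [h1, h2, h3]
  rw [← plusProd]
  ring

lemma isCompl_range_add_sub :
    IsCompl (Set.range fun x : ℤ × ℤ => (x.1 + x.2, x.1 - x.2))
      (Set.range fun x : ℤ × ℤ => (x.1 + x.2 + 1, x.1 - x.2)) := by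
  rw [isCompl_iff, Set.disjoint_left, codisjoint_iff]
  constructor
  · rintro ⟨m, n⟩ ⟨⟨a, b⟩, h⟩ ⟨⟨c, d⟩, h'⟩
    simp only [Prod.mk.injEq] at h h'
    omega
  · refine Set.eq_univ_iff_forall.mpr ?_
    rintro ⟨m, n⟩
    rcases Int.even_or_odd' (m + n) with ⟨c, hc | hc⟩
    · exact Or.inl ⟨(c, m - c), by simp only [Prod.mk.injEq]; omega⟩
    · exact Or.inr ⟨(c, c - n), by simp only [Prod.mk.injEq]; omega⟩

lemma injective_add_sub : Function.Injective fun x : ℤ × ℤ => (x.1 + x.2, x.1 - x.2) := by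
  rintro ⟨a, b⟩ ⟨c, d⟩ h
  simp only [Prod.mk.injEq] at h ⊢
  omega

lemma injective_add_one_sub :
    Function.Injective fun x : ℤ × ℤ => (x.1 + x.2 + 1, x.1 - x.2) := by
  rintro ⟨a, b⟩ ⟨c, d⟩ h
  simp only [Prod.mk.injEq] at h ⊢
  omega

lemma hasSum_mul_self {f : ℤ → ℂ} (hf : Summable fun j => ‖f j‖) :
    HasSum (fun x : ℤ × ℤ => f x.1 * f x.2) ((∑' j, f j) ^ 2) := by
  rw [sq, tsum_mul_tsum_of_summable_norm hf hf]
  exact (summable_mul_of_summable_norm hf hf).hasSum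

lemma thetaSq_sq {q : ℂ} (h0 : q ≠ 0) (hq : ‖q‖ < 1) :
    thetaSq q ^ 2 = thetaSq (q ^ 2) ^ 2 + q * thetaPronic (q ^ 2) ^ 2 := by
  have hp := norm_sq_lt_one hq
  have hp0 : q ^ 2 ≠ 0 := pow_ne_zero 2 h0
  have hpq : ∀ m : ℤ, (q ^ 2) ^ m = q ^ (2 * m) := fun m => by
    rw [zpow_mul, zpow_ofNat]
  have h := hasSum_mul_self (summable_norm_zpow_sq h0 hq)
  have k1 := hasSum_mul_self (summable_norm_zpow_sq hp0 hp)
  have k2 := (hasSum_mul_self (summable_norm_zpow_pronic hp0 hp)).mul_left q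
  have e1 : ∀ a b : ℤ, q ^ ((a + b) ^ 2) * q ^ ((a - b) ^ 2) =
      (q ^ 2) ^ (a ^ 2) * (q ^ 2) ^ (b ^ 2) := fun a b => by
    rw [hpq, hpq, ← zpow_add₀ h0, ← zpow_add₀ h0]
    congr 1; ring
  have e2 : ∀ a b : ℤ, q ^ ((a + b + 1) ^ 2) * q ^ ((a - b) ^ 2) =
      q * ((q ^ 2) ^ (a ^ 2 + a) * (q ^ 2) ^ (b ^ 2 + b)) := fun a b => by
    rw [hpq, hpq, ← zpow_add₀ h0, ← zpow_add₀ h0, ← zpow_one_add₀ h0]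
    congr 1; ring
  set F : ℤ × ℤ → ℂ := fun x => q ^ (x.1 ^ 2) * q ^ (x.2 ^ 2)
  have l1 : HasSum (F ∘ fun x : ℤ × ℤ => (x.1 + x.2, x.1 - x.2)) (thetaSq (q ^ 2) ^ 2) :=
    hasSum_of_eq k1 (fun x => e1 x.1 x.2) rfl
  have l2 : HasSum (F ∘ fun x : ℤ × ℤ => (x.1 + x.2 + 1, x.1 - x.2))
      (q * thetaPronic (q ^ 2) ^ 2) :=
    hasSum_of_eq k2 (fun x => e2 x.1 x.2) rfl
  exact h.unique (HasSum.add_isCompl isCompl_range_add_sub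
    (injective_add_sub.hasSum_range_iff.mpr l1) (injective_add_one_sub.hasSum_range_iff.mpr l2))

lemma qpow_natCast (τ : ℂ) (n : ℕ) : qpow τ n = qpow τ 1 ^ n := by
  rw [qpow, qpow, ← Complex.exp_nat_mul]
  congr 1; push_cast; ring

lemma norm_qpow_one_lt {τ : ℂ} (hτ : 0 < τ.im) : ‖qpow τ 1‖ < 1 := by
  rw [qpow, Complex.norm_exp, Real.exp_lt_one_iff]
  have : 0 < Real.pi * τ.im := mul_pos Real.pi_pos hτ
  simp
  nlinarith

lemma uRam_eq {τ : ℂ} (hτ : 0 < τ.im) :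
    uRam τ = (Real.sqrt 2 : ℂ) * qpow τ (1/8) *
      (plusProd (qpow τ 1 ^ 2) / oddPlusProd (qpow τ 1)) := by
  have hq := norm_qpow_one_lt hτ
  set q := qpow τ 1 with hqdef
  have hf : ∀ n : ℕ, qpow τ ((n : ℝ) + 1) = q ^ (n + 1) := fun n => by
    rw [hqdef, ← qpow_natCast]; push_cast; rfl
  have he : HasProd (fun k : ℕ => (1 + q ^ (2 * k + 1)) ^ ((-1 : ℤ) ^ (2 * k + 1)))
      (oddPlusProd q)⁻¹ := by
    have := (multipliable_one_add_pow_odd hq).hasProd.inv₀ (oddPlusProd_ne_zero hq)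
    simpa only [oddPlusProd, Odd.neg_one_pow ⟨_, rfl⟩, zpow_neg_one] using this
  have ho : HasProd (fun k : ℕ => (1 + q ^ (2 * k + 1 + 1)) ^ ((-1 : ℤ) ^ (2 * k + 1 + 1)))
      (plusProd (q ^ 2)) := by
    have := (multipliable_one_add_pow_succ (norm_sq_lt_one hq)).hasProd
    have hev : ∀ k : ℕ, Even (2 * k + 1 + 1) := fun k => ⟨k + 1, by ring⟩
    have hpw : ∀ k : ℕ, q ^ (2 * k + 1 + 1) = (q ^ 2) ^ (k + 1) := fun k => by
      rw [← pow_mul]; rfl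
    simpa only [plusProd, (hev _).neg_one_pow, zpow_one, hpw] using this
  have h := he.even_mul_odd (f := fun n : ℕ => (1 + q ^ (n + 1)) ^ ((-1 : ℤ) ^ (n + 1))) ho
  rw [uRam]
  simp only [hf]
  rw [h.tprod_eq, inv_mul_eq_div]

/-- If `τ` lies in the upper half-plane, `x = u(τ)` and `y = u(2τ)`,
then `x⁴(y⁴ + 1) = 2y²`. -/
theorem u_duplication (τ : ℂ) (hτ : 0 < τ.im) :
    uRam τ ^ 4 * (uRam (2 * τ) ^ 4 + 1) = 2 * uRam (2 * τ) ^ 2 := by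
  have hτ2 : 0 < (2 * τ).im := by simpa using hτ
  have hq := norm_qpow_one_lt hτ
  have h0 : qpow τ 1 ≠ 0 := Complex.exp_ne_zero _
  have e1 : qpow (2 * τ) 1 = qpow τ 1 ^ 2 := by
    rw [qpow, qpow, ← Complex.exp_nat_mul]; congr 1; push_cast; ring
  have e2 : qpow (2 * τ) (1 / 8) = qpow τ (1 / 8) ^ 2 := by
    rw [qpow, qpow, ← Complex.exp_nat_mul]; congr 1; push_cast; ring
  have e3 : qpow τ 1 = qpow τ (1 / 8) ^ 8 := by
    rw [qpow, qpow, ← Complex.exp_nat_mul]; congr 1; push_cast; ring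
  rw [uRam_eq hτ, uRam_eq hτ2, e1, e2]
  have hs : (Real.sqrt 2 : ℂ) ^ 2 = 2 := by
    rw [← Complex.ofReal_pow, Real.sq_sqrt zero_le_two, Complex.ofReal_ofNat]
  set q := qpow τ 1
  set r := qpow τ (1 / 8)
  have hp := norm_sq_lt_one hq
  have hp0 : q ^ 2 ≠ 0 := pow_ne_zero 2 h0
  have t := thetaSq_sq h0 hq
  rw [thetaSq_eq_prod h0 hq, thetaSq_eq_prod hp0 hp, thetaPronic_eq_prod hp0 hp] at t
  have hE := eulerProd_mul_plusProd hp
  have hG := oddPlusProd_mul_plusProd_sq hp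
  have hH := oddPlusProd_ne_zero hq
  have hH2 := oddPlusProd_ne_zero hp
  have hE0 := eulerProd_ne_zero (norm_sq_lt_one hp)
  set E := eulerProd (q ^ 2)
  set E2 := eulerProd ((q ^ 2) ^ 2)
  set G := plusProd (q ^ 2)
  set G2 := plusProd ((q ^ 2) ^ 2)
  set H := oddPlusProd q
  set H2 := oddPlusProd (q ^ 2)
  have key : G ^ 4 * (4 * q * G2 ^ 4 + H2 ^ 4) = G2 ^ 2 * H2 ^ 2 * H ^ 4 := by
    apply mul_left_cancel₀ (pow_ne_zero 2 hE0)
    have : E2 ^ 2 * (G2 ^ 2 * H2 ^ 2) = G ^ 4 * E ^ 2 := by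
      rw [← hE, ← hG]; ring
    linear_combination (-G ^ 4) * t - H ^ 4 * this
  have hs4 : (Real.sqrt 2 : ℂ) ^ 4 = 4 := by
    rw [show 4 = 2 * 2 from rfl, pow_mul, hs]; norm_num
  simp only [mul_pow, div_pow, hs, hs4]
  field_simp
  rw [e3] at key
  linear_combination (4 * r ^ 4) * key
end

section
/- Let τ lie in the complex upper half-plane. Then (σ·v(τ/4) + 1)·v(−1/τ) = −v(τ/4) + σ, where σ = −1 + √2; that is, v(−1/τ) = (−v(τ/4) + σ)/(σ·v(τ/4) + 1) whenever the denominator is nonzero. -/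
/-- The Kronecker symbol `(2/n)`: `+1` if `n ≡ ±1 (mod 8)`, `-1` if `n ≡ ±3 (mod 8)`,
`0` if `n` is even. -/
def chi8 (n : ℕ) : ℤ :=
  if n % 8 = 1 ∨ n % 8 = 7 then 1 else if n % 8 = 3 ∨ n % 8 = 5 then -1 else 0

/-- Ramanujan's continued fraction value
`v(τ) = q^{1/2} ∏_{n≥1} (1 - q^n)^{χ₈(n)}`, `q = exp(2πiτ)`. -/
noncomputable def vRam (τ : ℂ) : ℂ :=
  qpow τ (1/2) * ∏' n : ℕ, (1 - qpow τ ((n : ℝ) + 1)) ^ chi8 (n + 1)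

open Complex Finset Filter Topology
open scoped Real

/-- The finite `q`-factorial `∏_{i<m} (1 - Q^(i+1))`. -/
noncomputable def qFac (Q : ℂ) (m : ℕ) : ℂ := ∏ i ∈ range m, (1 - Q ^ (i + 1))

/-- The reciprocal `q`-factorial, extended by zero to negative integers. -/
noncomputable def qFacInv (Q : ℂ) : ℤ → ℂ
  | Int.ofNat m => (qFac Q m)⁻¹
  | Int.negSucc _ => 0

lemma one_sub_pow_succ_ne_zero_s3 {Q : ℂ} (hQ : ‖Q‖ < 1) (n : ℕ) : 1 - Q ^ (n + 1) ≠ 0 := by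
  intro h
  have h1 : ‖Q ^ (n + 1)‖ < 1 := by
    rw [norm_pow]
    exact pow_lt_one₀ (norm_nonneg _) hQ n.succ_ne_zero
  rw [← sub_eq_zero.mp h, norm_one] at h1
  exact lt_irrefl _ h1

lemma qFac_succ (Q : ℂ) (m : ℕ) : qFac Q (m + 1) = qFac Q m * (1 - Q ^ (m + 1)) :=
  prod_range_succ _ _

lemma qFacInv_sub_one {Q : ℂ} (hQ : ‖Q‖ < 1) (m : ℤ) :
    qFacInv Q (m - 1) = (1 - Q ^ m) * qFacInv Q m := by
  rcases m with (_ | m) | m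
  · change qFacInv Q (Int.negSucc 0) = _
    simp [qFacInv]
  · have : Int.ofNat (m + 1) - 1 = Int.ofNat m := by simp
    rw [this]
    simp only [qFacInv, Int.ofNat_eq_natCast, zpow_natCast, qFac_succ]
    have := one_sub_pow_succ_ne_zero_s3 hQ m
    field_simp
  · change qFacInv Q (Int.negSucc (m + 1)) = _
    simp [qFacInv]

lemma tendsto_qFac {Q : ℂ} (hQ : ‖Q‖ < 1) :
    Tendsto (qFac Q) atTop (𝓝 (∏' n : ℕ, (1 - Q ^ (n + 1)))) :=
  (ModularForm.multipliable_one_sub_pow hQ).hasProd.tendsto_prod_nat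

lemma tprod_one_sub_pow_ne_zero {Q : ℂ} (hQ : ‖Q‖ < 1) : ∏' n : ℕ, (1 - Q ^ (n + 1)) ≠ 0 := by
  simp_rw [sub_eq_add_neg]
  refine tprod_one_add_ne_zero_of_summable (fun i ↦ ?_) ?_
  · simpa [sub_eq_add_neg] using one_sub_pow_succ_ne_zero_s3 hQ i
  · simpa using (summable_nat_add_iff 1).mpr (summable_geometric_of_lt_one (norm_nonneg _) hQ)

lemma tendsto_qFacInv {Q : ℂ} (hQ : ‖Q‖ < 1) :
    Tendsto (qFacInv Q) atTop (𝓝 (∏' n : ℕ, (1 - Q ^ (n + 1)))⁻¹) := by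
  have h := (tendsto_qFac hQ).inv₀ (tprod_one_sub_pow_ne_zero hQ)
  have h2 : Tendsto Int.toNat atTop atTop :=
    tendsto_atTop_atTop.2 fun b ↦ ⟨b, fun a ha ↦ by lia⟩
  refine (h.comp h2).congr' ?_
  filter_upwards [eventually_ge_atTop 0] with m hm
  lift m to ℕ using hm
  rfl

lemma exists_norm_qFac_le {Q : ℂ} (hQ : ‖Q‖ < 1) : ∃ C, ∀ m, ‖qFac Q m‖ ≤ C := by
  obtain ⟨C, hC⟩ := (tendsto_qFac hQ).norm.bddAbove_range
  exact ⟨C, fun m ↦ hC ⟨m, rfl⟩⟩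

lemma exists_norm_qFacInv_le {Q : ℂ} (hQ : ‖Q‖ < 1) : ∃ C, ∀ m, ‖qFacInv Q m‖ ≤ C := by
  obtain ⟨C, hC⟩ := ((tendsto_qFac hQ).inv₀ (tprod_one_sub_pow_ne_zero hQ)).norm.bddAbove_range
  refine ⟨C, fun m ↦ ?_⟩
  rcases m with m | m
  · exact hC ⟨m, rfl⟩
  · exact le_trans (by simp [qFacInv]) (hC ⟨0, rfl⟩)

/-- Finite form of the Jacobi triple product. -/
lemma hasSum_finite_triple_product {Q y : ℂ} (hQ : ‖Q‖ < 1) (hQ0 : Q ≠ 0) (hy : y ≠ 0)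
    {t : ℤ → ℂ} (ht0 : t 0 = 1) (ht : ∀ n, t (n + 1) = -y * Q ^ n * t n) (N : ℕ) :
    HasSum (fun n : ℤ ↦ qFac Q (2 * N) * qFacInv Q (N + n) * qFacInv Q (N - n) * t n)
      (∏ k ∈ range N, ((1 - y * Q ^ k) * (1 - y⁻¹ * Q ^ (k + 1)))) := by
  induction N with
  | zero =>
    rw [range_zero, prod_empty]
    convert hasSum_ite_eq (0 : ℤ) (1 : ℂ) using 2 with n
    rcases n with (_ | n) | n
    · simp [qFac, qFacInv, ht0]
    · have : -(n + 1 : ℤ) = Int.negSucc n := by lia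
      simp [qFacInv, this]
      lia
    · simp [qFacInv]
  | succ N ih =>
    rw [prod_range_succ]
    have h1 := (Equiv.subRight (1 : ℤ)).hasSum_iff.mpr ih
    have h2 := (Equiv.addRight (1 : ℤ)).hasSum_iff.mpr ih
    have h := ((ih.mul_left (1 + Q ^ (2 * N + 1))).sub (h1.mul_left (y * Q ^ N))).sub
      (h2.mul_left (y⁻¹ * Q ^ (N + 1)))
    convert! h using 1
    · funext n
      simp only [Function.comp_apply, Equiv.subRight_apply, Equiv.coe_addRight]
      set S := qFacInv Q (N + 1 + n)
      set S' := qFacInv Q (N + 1 - n)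
      have e1 : qFacInv Q (N + n) = (1 - Q ^ (N + 1 + n : ℤ)) * S := by
        rw [← qFacInv_sub_one hQ]; congr 1; ring
      have e2 : qFacInv Q (N - n) = (1 - Q ^ (N + 1 - n : ℤ)) * S' := by
        rw [← qFacInv_sub_one hQ]; congr 1; ring
      have e3 : qFacInv Q (N + (n - 1)) = (1 - Q ^ (N + n : ℤ)) * qFacInv Q (N + n) := by
        rw [← qFacInv_sub_one hQ]; congr 1; ring
      have e4 : qFacInv Q (N - (n + 1)) = (1 - Q ^ (N - n : ℤ)) * qFacInv Q (N - n) := by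
        rw [← qFacInv_sub_one hQ]; congr 1; ring
      have e5 : (N - (n - 1) : ℤ) = N + 1 - n := by ring
      have e6 : (N + (n + 1) : ℤ) = N + 1 + n := by ring
      have e7 : t n = -y * Q ^ (n - 1) * t (n - 1) := by rw [← ht]; simp
      have hF : qFac Q (2 * (N + 1)) =
          qFac Q (2 * N) * (1 - Q ^ (2 * N + 1)) * (1 - Q ^ (2 * N + 2)) := by
        rw [show 2 * (N + 1) = 2 * N + 1 + 1 by ring, qFac_succ, qFac_succ]
      rw [e3, e4, e5, e6, e1, e2, ht, e7, hF]
      push_cast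
      simp only [zpow_add₀ hQ0, zpow_sub₀ hQ0, zpow_natCast, zpow_one]
      have hu : Q ^ n ≠ 0 := zpow_ne_zero _ hQ0
      set u := Q ^ n
      field_simp
      ring
    · field_simp
      ring

/-- The Jacobi triple product, as a limit of partial products. -/
lemma tendsto_triple_product {T : ℂ} (hT : 0 < T.im) (w : ℂ) :
    Tendsto (fun N : ℕ ↦ ∏ k ∈ range N, ((1 - cexp (2 * π * I * w) * cexp (2 * π * I * T) ^ k) *
      (1 - (cexp (2 * π * I * w))⁻¹ * cexp (2 * π * I * T) ^ (k + 1)))) atTop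
      (𝓝 ((∏' n : ℕ, (1 - cexp (2 * π * I * T) ^ (n + 1)))⁻¹ *
        jacobiTheta₂ (1 / 2 + w - T / 2) T)) := by
  have hQ : ‖cexp (2 * π * I * T)‖ < 1 := by
    simpa using UpperHalfPlane.norm_exp_two_pi_I_lt_one ⟨T, hT⟩
  have ht (n : ℤ) : jacobiTheta₂_term (n + 1) (1 / 2 + w - T / 2) T =
      -cexp (2 * π * I * w) * cexp (2 * π * I * T) ^ n *
        jacobiTheta₂_term n (1 / 2 + w - T / 2) T := by
    have h : -cexp (2 * π * I * w) = cexp (π * I + 2 * π * I * w) := by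
      rw [exp_add, exp_pi_mul_I, neg_one_mul]
    rw [h, jacobiTheta₂_term, jacobiTheta₂_term, ← exp_int_mul, ← exp_add, ← exp_add]
    push_cast
    ring_nf
  set Q := cexp (2 * π * I * T)
  have key := hasSum_finite_triple_product hQ (exp_ne_zero _) (exp_ne_zero (2 * π * I * w))
    (t := fun n ↦ jacobiTheta₂_term n (1 / 2 + w - T / 2) T) (by simp [jacobiTheta₂_term]) ht
  simp_rw [← (key _).tsum_eq, jacobiTheta₂, ← tsum_mul_left]
  obtain ⟨C, hC⟩ := exists_norm_qFac_le hQ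
  obtain ⟨D, hD⟩ := exists_norm_qFacInv_le hQ
  refine tendsto_tsum_of_dominated_convergence
    (bound := fun n ↦ C * D * D * ‖jacobiTheta₂_term n (1 / 2 + w - T / 2) T‖) ?_ ?_ ?_
  · exact (((summable_jacobiTheta₂_term_iff _ _).mpr hT).norm).mul_left _
  · intro n
    refine Tendsto.mul_const _ ?_
    have hP := tprod_one_sub_pow_ne_zero hQ
    have h1 : Tendsto (fun N : ℕ ↦ qFac Q (2 * N)) atTop _ :=
      (tendsto_qFac hQ).comp (tendsto_id.const_mul_atTop' two_pos)
    have h2 : Tendsto (fun N : ℕ ↦ qFacInv Q (N + n)) atTop _ :=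
      (tendsto_qFacInv hQ).comp (tendsto_atTop_add_const_right _ n tendsto_natCast_atTop_atTop)
    have h3 : Tendsto (fun N : ℕ ↦ qFacInv Q (N - n)) atTop _ :=
      (tendsto_qFacInv hQ).comp (tendsto_atTop_add_const_right _ (-n) tendsto_natCast_atTop_atTop)
    convert (h1.mul h2).mul h3 using 2
    field_simp
  · refine Eventually.of_forall fun N n ↦ ?_
    have hC0 := (norm_nonneg _).trans (hC 0)
    have hD0 := (norm_nonneg _).trans (hD 0)
    simp only [norm_mul]
    gcongr
    exacts [hC _, hD _, hD _]

lemma qpow_eq_pow (τ : ℂ) (n : ℕ) : qpow τ n = cexp (2 * π * I * τ) ^ n := by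
  rw [qpow, ← exp_nat_mul]
  push_cast
  ring_nf

lemma multipliable_chi8 {q : ℂ} (hq : ‖q‖ < 1) :
    Multipliable fun n : ℕ ↦ (1 - q ^ (n + 1)) ^ chi8 (n + 1) := by
  have h (n : ℕ) : (1 - q ^ (n + 1)) ^ chi8 (n + 1) =
      1 + ((1 - q ^ (n + 1)) ^ chi8 (n + 1) - 1) := by ring
  rw [funext h]
  have hpos : 0 < 1 - ‖q‖ := sub_pos.mpr hq
  refine multipliable_one_add_of_summable (Summable.of_nonneg_of_le (fun _ ↦ norm_nonneg _)
    (fun n ↦ ?_) (((summable_nat_add_iff 1).mpr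
      (summable_geometric_of_lt_one (norm_nonneg q) hq)).mul_right (1 - ‖q‖)⁻¹))
  have hx : ‖q ^ (n + 1)‖ ≤ ‖q‖ := by
    rw [norm_pow]
    exact pow_le_of_le_one (norm_nonneg _) hq.le n.succ_ne_zero
  have hne := one_sub_pow_succ_ne_zero_s3 hq n
  rw [← norm_pow]
  set x := q ^ (n + 1)
  have h1 : 1 ≤ (1 - ‖q‖)⁻¹ := (one_le_inv₀ hpos).mpr (by linarith [norm_nonneg q])
  unfold chi8
  split_ifs
  · simpa using le_mul_of_one_le_right (norm_nonneg x) h1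
  · have h2 : (1 - x) ^ (-1 : ℤ) - 1 = x * (1 - x)⁻¹ := by
      rw [zpow_neg_one]
      field_simp
      ring
    rw [h2, norm_mul, norm_inv]
    gcongr
    have := norm_sub_norm_le 1 x
    rw [norm_one] at this
    linarith
  · simp only [zpow_zero, sub_self, norm_zero]
    positivity

lemma prod_chi8 {q : ℂ} (hq0 : q ≠ 0) (N : ℕ) :
    ∏ n ∈ range (8 * N), (1 - q ^ (n + 1)) ^ chi8 (n + 1) =
      (∏ k ∈ range N, ((1 - q * (q ^ 8) ^ k) * (1 - q⁻¹ * (q ^ 8) ^ (k + 1)))) /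
      ∏ k ∈ range N, ((1 - q ^ 3 * (q ^ 8) ^ k) * (1 - (q ^ 3)⁻¹ * (q ^ 8) ^ (k + 1))) := by
  have c (j r : ℕ) : chi8 (8 * j + r) = chi8 r := by
    unfold chi8
    rw [Nat.mul_add_mod]
  rw [← prod_div_distrib]
  induction N with
  | zero => simp
  | succ N ih =>
    rw [prod_range_succ, ← ih, show 8 * (N + 1) = 8 * N + 1 + 1 + 1 + 1 + 1 + 1 + 1 + 1 by ring]
    simp only [prod_range_succ]
    simp only [add_assoc, Nat.reduceAdd, c, show chi8 1 = 1 from rfl, show chi8 2 = 0 from rfl,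
      show chi8 3 = -1 from rfl, show chi8 4 = 0 from rfl, show chi8 5 = -1 from rfl,
      show chi8 6 = 0 from rfl, show chi8 7 = 1 from rfl, show chi8 8 = 0 from rfl,
      zpow_one, zpow_zero, zpow_neg_one, mul_one]
    have e1 : q⁻¹ * (q ^ 8) ^ (N + 1) = q ^ (8 * N + 7) := by
      field_simp
      ring
    have e3 : (q ^ 3)⁻¹ * (q ^ 8) ^ (N + 1) = q ^ (8 * N + 5) := by
      field_simp
      ring
    have e1' : q * (q ^ 8) ^ N = q ^ (8 * N + 1) := by ring
    have e3' : q ^ 3 * (q ^ 8) ^ N = q ^ (8 * N + 3) := by ring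
    rw [e1, e3, e1', e3']
    simp only [div_eq_mul_inv, mul_inv]
    ring

lemma exists_tendsto_prod_one_sub {y Q : ℂ} (hy : ‖y‖ < 1) (hQ : ‖Q‖ < 1) :
    ∃ P ≠ 0, Tendsto (fun N : ℕ ↦ ∏ k ∈ range N, (1 - y * Q ^ k)) atTop (𝓝 P) := by
  have hs : Summable fun k : ℕ ↦ ‖-(y * Q ^ k)‖ := by
    simpa using (summable_geometric_of_lt_one (norm_nonneg Q) hQ).mul_left ‖y‖
  simp_rw [sub_eq_add_neg]
  refine ⟨_, tprod_one_add_ne_zero_of_summable (fun k h ↦ ?_) hs,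
    (multipliable_one_add_of_summable hs).hasProd.tendsto_prod_nat⟩
  have h1 : ‖y * Q ^ k‖ < 1 := by
    rw [norm_mul, norm_pow]
    exact mul_lt_one_of_nonneg_of_lt_one_left (norm_nonneg _) hy
      (pow_le_one₀ (norm_nonneg _) hQ.le)
  rw [← sub_eq_add_neg] at h
  rw [← sub_eq_zero.mp h, norm_one] at h1
  exact lt_irrefl _ h1

lemma jacobiTheta₂_half_sub_ne_zero {T w : ℂ} (hw : 0 < w.im) (hwT : w.im < T.im) :
    jacobiTheta₂ (1 / 2 + w - T / 2) T ≠ 0 := by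
  have hn {z : ℂ} (hz : 0 < z.im) : ‖cexp (2 * π * I * z)‖ < 1 :=
    UpperHalfPlane.norm_exp_two_pi_I_lt_one ⟨z, hz⟩
  have hT := hw.trans hwT
  obtain ⟨P, hP, h1⟩ := exists_tendsto_prod_one_sub (hn hw) (hn hT)
  obtain ⟨P', hP', h2⟩ := exists_tendsto_prod_one_sub
    (hn (z := T - w) (by simpa using hwT)) (hn hT)
  have h3 := tendsto_triple_product hT w
  have e (k : ℕ) : (cexp (2 * π * I * w))⁻¹ * cexp (2 * π * I * T) ^ (k + 1) =
      cexp (2 * π * I * (T - w)) * cexp (2 * π * I * T) ^ k := by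
    rw [mul_sub, exp_sub]
    ring
  simp_rw [e, prod_mul_distrib] at h3
  have h4 := tendsto_nhds_unique h3 (h1.mul h2)
  exact right_ne_zero_of_mul (h4 ▸ mul_ne_zero hP hP')

lemma jacobiTheta₂_eq_sum_four (z : ℂ) {T : ℂ} (hT : 0 < T.im) :
    jacobiTheta₂ z T = ∑ r : Fin 4, cexp (2 * π * I * (((r : ℕ) : ℂ) - 1) * z +
      π * I * (((r : ℕ) : ℂ) - 1) ^ 2 * T) *
      jacobiTheta₂ (4 * z + 4 * (((r : ℕ) : ℂ) - 1) * T) (16 * T) := by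
  let e : Fin 4 × ℤ ≃ ℤ :=
    ((Equiv.prodComm _ _).trans (Int.divModEquiv 4).symm).trans (Equiv.subRight 1)
  have hs := e.summable_iff.mpr ((summable_jacobiTheta₂_term_iff z T).mpr hT)
  rw [jacobiTheta₂, ← e.tsum_eq]
  refine hs.tsum_prod.trans ?_
  rw [tsum_fintype]
  refine sum_congr rfl fun r _ ↦ ?_
  rw [jacobiTheta₂, ← tsum_mul_left]
  refine tsum_congr fun n ↦ ?_
  simp only [e, Function.comp_apply, Equiv.trans_apply, Equiv.prodComm_apply, Prod.swap_prod_mk,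
    Int.divModEquiv_symm_apply, Equiv.subRight_apply, jacobiTheta₂_term, ← Complex.exp_add]
  push_cast
  ring_nf

/-- The theta series `∑ (-1)^n q^{4(n - a/8)^2}`, `q = exp(2πis)`, summed over all integers `n`. -/
noncomputable def thetaOct (a : ℂ) (s : ℂ) : ℂ :=
  cexp (π * I * a ^ 2 * s / 8) * jacobiTheta₂ (1 / 2 - a * s) (8 * s)

lemma jacobiTheta₂_add_two (z τ : ℂ) : jacobiTheta₂ (z + 2) τ = jacobiTheta₂ z τ := by
  rw [← one_add_one_eq_two, ← add_assoc, jacobiTheta₂_add_left, jacobiTheta₂_add_left]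

lemma jacobiTheta₂_half_sub (x τ : ℂ) :
    jacobiTheta₂ (1 / 2 - x) τ = jacobiTheta₂ (1 / 2 + x) τ := by
  rw [← jacobiTheta₂_neg_left, ← jacobiTheta₂_add_left]
  ring_nf

lemma thetaOct_inversion {s a : ℂ} (hs : 0 < s.im) (ha : a = 1 ∨ a = 3) :
    thetaOct a (-1 / (4 * s)) = 2 / (-I * (8 * (-1 / (4 * s)))) ^ (1 / 2 : ℂ) *
      (Complex.cos (π * a / 8) * thetaOct 1 s + Complex.cos (3 * π * a / 8) * thetaOct 3 s) := by
  have hs0 : s ≠ 0 := by rintro rfl; simp at hs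
  have h1 : (1 / 2 - a * (-1 / (4 * s))) / (8 * (-1 / (4 * s))) = -s / 4 - a / 8 := by
    field_simp
    ring
  have h2 : -1 / (8 * (-1 / (4 * s))) = s / 2 := by
    field_simp
    ring
  have h3 : 0 < (s / 2).im := by simpa using hs
  have h4 (x : ℂ) : jacobiTheta₂ (x - a / 2) (8 * s) = jacobiTheta₂ (1 / 2 + x) (8 * s) := by
    rcases ha with rfl | rfl
    · rw [← jacobiTheta₂_add_left]
      ring_nf
    · rw [← jacobiTheta₂_add_two]
      ring_nf
  have h5 (r : ℂ) : jacobiTheta₂ (4 * (-s / 4 - a / 8) + 4 * r * (s / 2)) (16 * (s / 2)) =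
      jacobiTheta₂ (1 / 2 + (2 * r - 1) * s) (8 * s) := by
    rw [← h4]
    ring_nf
  have h6 : cexp (π * I * a ^ 2 * (-1 / (4 * s)) / 8) *
      cexp (-π * I * (1 / 2 - a * (-1 / (4 * s))) ^ 2 / (8 * (-1 / (4 * s)))) =
      cexp (π * I * (s / 8 + a / 8)) := by
    rw [← Complex.exp_add]
    congr 1
    field_simp
    ring
  rw [thetaOct, jacobiTheta₂_functional_equation, h1, h2, jacobiTheta₂_eq_sum_four _ h3]
  simp_rw [h5]
  rw [mul_assoc (1 / _), mul_left_comm, ← mul_assoc (cexp _) (cexp _), h6, mul_sum,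
    Fin.sum_univ_four]
  simp_rw [← mul_assoc (cexp _) (cexp _), ← Complex.exp_add]
  have f0 : (((0 : Fin 4) : ℕ) : ℂ) = 0 := by simp
  have f1 : (((1 : Fin 4) : ℕ) : ℂ) = 1 := by simp
  have f2 : (((2 : Fin 4) : ℕ) : ℂ) = 2 := by norm_num
  have f3 : (((3 : Fin 4) : ℕ) : ℂ) = 3 := by norm_num
  have t0 : jacobiTheta₂ (1 / 2 + (2 * (0 - 1) - 1) * s) (8 * s) =
      jacobiTheta₂ (1 / 2 - 3 * s) (8 * s) := by
    ring_nf
  have t1 : jacobiTheta₂ (1 / 2 + (2 * (1 - 1) - 1) * s) (8 * s) =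
      jacobiTheta₂ (1 / 2 - 1 * s) (8 * s) := by
    ring_nf
  have t2 : jacobiTheta₂ (1 / 2 + (2 * (2 - 1) - 1) * s) (8 * s) =
      jacobiTheta₂ (1 / 2 - 1 * s) (8 * s) := by
    rw [jacobiTheta₂_half_sub]
    norm_num
  have t3 : jacobiTheta₂ (1 / 2 + (2 * (3 - 1) - 1) * s) (8 * s) =
      jacobiTheta₂ (1 / 2 - 3 * s) (8 * s) := by
    rw [jacobiTheta₂_half_sub]
    norm_num
  have p (r c d : ℂ) (h : π * I * (s / 8 + a / 8) +
      (2 * π * I * (r - 1) * (-s / 4 - a / 8) + π * I * (r - 1) ^ 2 * (s / 2)) = c * I + d) :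
      cexp (π * I * (s / 8 + a / 8) + (2 * π * I * (r - 1) * (-s / 4 - a / 8) +
        π * I * (r - 1) ^ 2 * (s / 2))) = cexp (c * I) * cexp d := by
    rw [h, Complex.exp_add]
  rw [f0, f1, f2, f3, t0, t1, t2, t3,
    p 0 (3 * π * a / 8) (π * I * 3 ^ 2 * s / 8) (by ring),
    p 1 (π * a / 8) (π * I * 1 ^ 2 * s / 8) (by ring),
    p 2 (-(π * a / 8)) (π * I * 1 ^ 2 * s / 8) (by ring),
    p 3 (-(3 * π * a / 8)) (π * I * 3 ^ 2 * s / 8) (by ring)]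
  simp only [thetaOct, Complex.cos]
  ring

lemma thetaOct_one_ne_zero {τ : ℂ} (hτ : 0 < τ.im) : thetaOct 1 τ ≠ 0 := by
  refine mul_ne_zero (exp_ne_zero _) ?_
  have h := jacobiTheta₂_half_sub_ne_zero (T := 8 * τ) (w := 3 * τ) (by simpa using hτ)
    (by simp; linarith)
  convert h using 2
  ring

lemma vRam_eq {τ : ℂ} (hτ : 0 < τ.im) : vRam τ = thetaOct 3 τ / thetaOct 1 τ := by
  have hq : ‖cexp (2 * π * I * τ)‖ < 1 := UpperHalfPlane.norm_exp_two_pi_I_lt_one ⟨τ, hτ⟩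
  have hT : 0 < (8 * τ).im := by simpa using hτ
  have hw : cexp (2 * π * I * (3 * τ)) = cexp (2 * π * I * τ) ^ 3 := by
    rw [← exp_nat_mul]
    push_cast
    ring_nf
  have hQ : cexp (2 * π * I * (8 * τ)) = cexp (2 * π * I * τ) ^ 8 := by
    rw [← exp_nat_mul]
    push_cast
    ring_nf
  have hQ1 : ‖cexp (2 * π * I * (8 * τ))‖ < 1 :=
    UpperHalfPlane.norm_exp_two_pi_I_lt_one ⟨8 * τ, hT⟩
  have hP := tprod_one_sub_pow_ne_zero hQ1
  have hne := thetaOct_one_ne_zero hτ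
  have l1 := tendsto_triple_product hT τ
  have l3 := tendsto_triple_product hT (3 * τ)
  rw [show 1 / 2 + τ - 8 * τ / 2 = 1 / 2 - 3 * τ by ring] at l1
  rw [show 1 / 2 + 3 * τ - 8 * τ / 2 = 1 / 2 - 1 * τ by ring] at l3
  have hθ := right_ne_zero_of_mul hne
  have l := l1.div l3 (mul_ne_zero (inv_ne_zero hP) hθ)
  have lv := (multipliable_chi8 hq).hasProd.tendsto_prod_nat.comp
    (tendsto_id.const_mul_atTop' (show 0 < 8 by norm_num))
  have hv : vRam τ = qpow τ (1 / 2) *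
      ∏' n : ℕ, (1 - cexp (2 * π * I * τ) ^ (n + 1)) ^ chi8 (n + 1) := by
    rw [vRam]
    congr! 5 with n
    exact_mod_cast qpow_eq_pow τ (n + 1)
  have hu := tendsto_nhds_unique lv (l.congr fun N ↦ by
    simp only [Function.comp_apply, id, prod_chi8 (exp_ne_zero _), hw, hQ, Pi.div_apply])
  rw [hv, hu, thetaOct, thetaOct, qpow, mul_div_mul_left _ _ (inv_ne_zero hP), mul_div_mul_comm,
    ← exp_sub]
  push_cast
  ring_nf

lemma cos_three_pi_div_eight :
    Complex.cos (3 * π / 8) = (-1 + (√2 : ℝ)) * Complex.cos (π / 8) := by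
  have h : Complex.cos (π / 8) ^ 2 = (2 + (√2 : ℝ)) / 4 := by
    rw [show (π / 8 : ℂ) = ((π / 8 : ℝ) : ℂ) by push_cast; rfl, ← ofReal_cos,
      Real.cos_pi_div_eight]
    norm_cast
    rw [div_pow, Real.sq_sqrt (by positivity)]
    norm_num
  rw [show (3 * π / 8 : ℂ) = 3 * (π / 8) by ring, Complex.cos_three_mul]
  linear_combination 4 * Complex.cos (π / 8) * h

/-- If `τ` lies in the upper half-plane and `σ = -1 + √2`, then
`(σ·v(τ/4) + 1)·v(-1/τ) = -v(τ/4) + σ`. -/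
theorem v_inversion (τ : ℂ) (hτ : 0 < τ.im) (σ : ℂ) (hσ : σ = -1 + (Real.sqrt 2 : ℂ)) :
    (σ * vRam (τ / 4) + 1) * vRam (-1 / τ) = -vRam (τ / 4) + σ := by
  subst hσ
  have hs : 0 < (τ / 4).im := by simpa using hτ
  have hτ' : 0 < (-1 / τ).im := by
    have h0 : τ ≠ 0 := by rintro rfl; simp at hτ
    rw [neg_div, neg_im, one_div, inv_im, neg_div, neg_neg]
    exact div_pos hτ (normSq_pos.mpr h0)
  have h1 := thetaOct_inversion hs (a := 1) (Or.inl rfl)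
  have h3 := thetaOct_inversion hs (a := 3) (Or.inr rfl)
  have c : Complex.cos (3 * π * 3 / 8) = -Complex.cos (π / 8) := by
    rw [← Complex.cos_add_pi]
    ring_nf
  have hA := thetaOct_one_ne_zero hs
  have hB := thetaOct_one_ne_zero hτ'
  rw [vRam_eq hs, vRam_eq hτ']
  rw [mul_div_cancel₀ τ (by norm_num)] at h1 h3
  rw [c, mul_comm (π : ℂ) 3] at h3
  rw [mul_one, mul_one] at h1
  rw [cos_three_pi_div_eight] at h1 h3
  generalize thetaOct 1 (-1 / τ) = B at *
  generalize thetaOct 3 (-1 / τ) = A at *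
  field_simp
  rw [h1, h3]
  ring
end

section
/- Let τ lie in the complex upper half-plane. Then 2·v(τ) = 𝔭(8τ)·(1 − v(τ)²); equivalently, 2/𝔭(8τ) = 1/v(τ) − v(τ) whenever both sides are defined. -/
/-- `𝔭(τ) = 2 q^{1/16} ∏_{n≥1} ((1 + q^{n/2})/(1 + q^{n/2 - 1/4}))²`. -/
noncomputable def pWeb (τ : ℂ) : ℂ :=
  2 * qpow τ (1/16) *
    ∏' n : ℕ, ((1 + qpow τ (((n : ℝ) + 1) / 2)) / (1 + qpow τ (((n : ℝ) + 1) / 2 - 1/4))) ^ 2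

open Filter Topology Finset

/-- The Gaussian binomial coefficient, defined by its Pascal recursion. -/
def gaussBinomial (Q : ℂ) : ℕ → ℕ → ℂ
  | _, 0 => 1
  | 0, _ + 1 => 0
  | N + 1, k + 1 => Q ^ (k + 1) * gaussBinomial Q N (k + 1) + gaussBinomial Q N k

/-- The finite `q`-Pochhammer product `(Q; Q)_m`. -/
def qFactorial (Q : ℂ) (m : ℕ) : ℂ := ∏ i ∈ range m, (1 - Q ^ (i + 1))

/-- The infinite `q`-Pochhammer product `(a; p)_∞`. -/
noncomputable def qProd (a p : ℂ) : ℂ := ∏' n : ℕ, (1 - a * p ^ n)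

lemma gaussBinomial_zero_right (Q : ℂ) (N : ℕ) : gaussBinomial Q N 0 = 1 := by
  cases N <;> rfl

lemma gaussBinomial_succ (Q : ℂ) (N k : ℕ) : gaussBinomial Q (N + 1) (k + 1) =
    Q ^ (k + 1) * gaussBinomial Q N (k + 1) + gaussBinomial Q N k := rfl

lemma gaussBinomial_eq_zero (Q : ℂ) {N k : ℕ} (h : N < k) : gaussBinomial Q N k = 0 := by
  induction N generalizing k with
  | zero => obtain ⟨k, rfl⟩ := Nat.exists_eq_succ_of_ne_zero h.ne'; rfl
  | succ N ih =>
    obtain ⟨k, rfl⟩ := Nat.exists_eq_succ_of_ne_zero (Nat.ne_zero_of_lt h)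
    rw [Nat.succ_eq_add_one, gaussBinomial_succ, ih (by omega), ih (by omega)]
    simp

lemma qFactorial_succ (Q : ℂ) (m : ℕ) :
    qFactorial Q (m + 1) = qFactorial Q m * (1 - Q ^ (m + 1)) := prod_range_succ _ _

lemma gaussBinomial_mul_qFactorial (Q : ℂ) (a b : ℕ) :
    gaussBinomial Q (a + b) a * (qFactorial Q a * qFactorial Q b) = qFactorial Q (a + b) := by
  generalize hN : a + b = N
  induction N generalizing a b with
  | zero =>
    obtain ⟨rfl, rfl⟩ : a = 0 ∧ b = 0 := by omega
    simp [gaussBinomial_zero_right, qFactorial]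
  | succ N ih =>
    rcases a with _ | a
    · obtain rfl : b = N + 1 := by omega
      simp [gaussBinomial_zero_right, qFactorial]
    rw [gaussBinomial_succ, qFactorial_succ Q N]
    have h2 := ih a b (by omega)
    rcases b with _ | b
    · obtain rfl : a = N := by omega
      rw [gaussBinomial_eq_zero Q (Nat.lt_succ_self a), qFactorial_succ]
      linear_combination (1 - Q ^ (a + 1)) * h2
    have h1 := ih (a + 1) b (by omega)
    obtain rfl : N = a + 1 + b := by omega
    rw [qFactorial_succ] at h1 h2 ⊢
    rw [qFactorial_succ]
    linear_combination Q ^ (a + 1) * (1 - Q ^ (b + 1)) * h1 + (1 - Q ^ (a + 1)) * h2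

/-- The `q`-binomial theorem. -/
lemma prod_one_add_mul_pow (x Q : ℂ) (N : ℕ) : ∏ j ∈ range N, (1 + x * Q ^ j) =
    ∑ m ∈ range (N + 1), gaussBinomial Q N m * (x ^ m * Q ^ m.choose 2) := by
  induction N generalizing x with
  | zero => simp [gaussBinomial_zero_right]
  | succ N ih =>
    have h : ∏ j ∈ range N, (1 + x * Q ^ (j + 1)) = ∏ j ∈ range N, (1 + (x * Q) * Q ^ j) :=
      prod_congr rfl fun j _ ↦ by ring
    rw [prod_range_succ', h, ih, sum_range_succ' _ (N + 1)]
    simp only [gaussBinomial_succ, add_mul, sum_add_distrib, gaussBinomial_zero_right]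
    have h1 := sum_range_succ' (fun m ↦ gaussBinomial Q N m * ((x * Q) ^ m * Q ^ m.choose 2)) (N + 1)
    rw [sum_range_succ, gaussBinomial_eq_zero Q (Nat.lt_succ_self N)] at h1
    simp only [gaussBinomial_zero_right] at h1
    rw [pow_zero, mul_one, mul_add, mul_one, sum_mul]
    have h2 : ∀ m, Q ^ (m + 1) * gaussBinomial Q N (m + 1) * (x ^ (m + 1) * Q ^ (m + 1).choose 2) =
      gaussBinomial Q N (m + 1) * ((x * Q) ^ (m + 1) * Q ^ (m + 1).choose 2) := fun m ↦ by
        rw [mul_pow]; ring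
    have h3 : ∀ m, gaussBinomial Q N m * (x ^ (m + 1) * Q ^ (m + 1).choose 2) =
      gaussBinomial Q N m * ((x * Q) ^ m * Q ^ m.choose 2) * x := fun m ↦ by
        rw [Nat.choose_succ_succ' m 1, Nat.choose_one_right, mul_pow]; ring
    simp only [h2, h3]
    linear_combination h1

/-- The general term of the theta series. -/
noncomputable def thetaTerm (z Q : ℂ) (k : ℤ) : ℂ := z ^ k * Q ^ (k * (k - 1) / 2)

lemma two_mul_triangle (k : ℤ) : 2 * (k * (k - 1) / 2) = k * (k - 1) :=
  Int.mul_ediv_cancel' (Int.even_mul_pred_self k).two_dvd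

lemma thetaTerm_natCast_sub {z Q : ℂ} (hz : z ≠ 0) (hQ : Q ≠ 0) (m n : ℕ) :
    thetaTerm z Q (m - n) =
      thetaTerm z Q (-n) * ((z * (Q ^ n)⁻¹) ^ m * Q ^ m.choose 2) := by
  have h1 : ((m.choose 2 : ℕ) : ℤ) = m * (m - 1) / 2 := by
    rw [Nat.choose_two_right]
    rcases m with _ | m <;> simp
  have h : ((m : ℤ) - n) * (m - n - 1) / 2 =
      (-n : ℤ) * (-n - 1) / 2 + (m.choose 2 : ℕ) - n * m := by
    linarith [two_mul_triangle (m - n), two_mul_triangle (-n), two_mul_triangle m]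
  rw [thetaTerm, thetaTerm, h, sub_eq_neg_add (m : ℤ), zpow_add₀ hz, zpow_sub₀ hQ, zpow_add₀ hQ,
    zpow_natCast, zpow_natCast, mul_pow, inv_pow, ← pow_mul]
  norm_cast
  field_simp

lemma thetaTerm_neg_mul_prod {z Q : ℂ} (hz : z ≠ 0) (hQ : Q ≠ 0) (n : ℕ) :
    thetaTerm z Q (-n) * ∏ j ∈ range n, (1 + z * (Q ^ n)⁻¹ * Q ^ j) =
      ∏ j ∈ range n, (1 + z⁻¹ * Q ^ (j + 1)) := by
  induction n with
  | zero => simp [thetaTerm]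
  | succ n ih =>
    have h : ∏ j ∈ range n, (1 + z * (Q ^ (n + 1))⁻¹ * Q ^ (j + 1)) =
        ∏ j ∈ range n, (1 + z * (Q ^ n)⁻¹ * Q ^ j) := prod_congr rfl fun j _ ↦ by
          field_simp
          ring
    have ht : thetaTerm z Q (-(n + 1 : ℕ)) = thetaTerm z Q (-n) * (z⁻¹ * Q ^ (n + 1)) := by
      have h1 : (-(n + 1 : ℕ) : ℤ) * (-(n + 1 : ℕ) - 1) / 2 =
          (-n : ℤ) * (-n - 1) / 2 + (n + 1 : ℕ) := by
        have h2 := two_mul_triangle (-(n + 1 : ℕ))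
        have h3 := two_mul_triangle (-n)
        push_cast at *
        linarith
      have h2 : (-(n + 1 : ℕ) : ℤ) = -n + -1 := by push_cast; ring
      rw [thetaTerm, thetaTerm, h1, h2, zpow_add₀ hz, zpow_add₀ hQ, zpow_natCast, zpow_neg_one]
      ring
    rw [prod_range_succ', h, prod_range_succ _ n, ← ih, ht]
    field_simp
    ring

/-- The finite form of the Jacobi triple product. -/
lemma prod_mul_prod_eq_sum_thetaTerm {z Q : ℂ} (hz : z ≠ 0) (hQ : Q ≠ 0) (n : ℕ) :
    (∏ j ∈ range n, (1 + z * Q ^ j)) * ∏ j ∈ range n, (1 + z⁻¹ * Q ^ (j + 1)) =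
      ∑ m ∈ range (2 * n + 1), gaussBinomial Q (2 * n) m * thetaTerm z Q (m - n) := by
  have h := prod_one_add_mul_pow (z * (Q ^ n)⁻¹) Q (2 * n)
  have h1 : ∏ j ∈ range n, (1 + z * (Q ^ n)⁻¹ * Q ^ (n + j)) = ∏ j ∈ range n, (1 + z * Q ^ j) :=
    prod_congr rfl fun j _ ↦ by rw [pow_add]; field_simp
  simp_rw [thetaTerm_natCast_sub hz hQ, mul_left_comm _ (thetaTerm z Q (-n)), ← mul_sum]
  rw [← h, two_mul, prod_range_add, h1, ← thetaTerm_neg_mul_prod hz hQ]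
  ring

lemma multipliable_qProd (a : ℂ) {p : ℂ} (hp : ‖p‖ < 1) :
    Multipliable fun n : ℕ ↦ 1 - a * p ^ n := by
  simp_rw [sub_eq_add_neg]
  refine multipliable_one_add_of_summable ?_
  simpa using (summable_geometric_of_lt_one (norm_nonneg _) hp).mul_left ‖a‖

lemma hasProd_qProd (a : ℂ) {p : ℂ} (hp : ‖p‖ < 1) :
    HasProd (fun n : ℕ ↦ 1 - a * p ^ n) (qProd a p) :=
  (multipliable_qProd a hp).hasProd

lemma qProd_ne_zero {a p : ℂ} (ha : ‖a‖ < 1) (hp : ‖p‖ < 1) : qProd a p ≠ 0 := by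
  simp_rw [qProd, sub_eq_add_neg]
  refine tprod_one_add_ne_zero_of_summable (fun n h ↦ ?_) ?_
  · have h1 : ‖a * p ^ n‖ = 1 := by
      rw [← sub_eq_add_neg, sub_eq_zero] at h
      rw [← h, norm_one]
    rw [norm_mul, norm_pow] at h1
    nlinarith [pow_le_one₀ (norm_nonneg p) hp.le (n := n), norm_nonneg a,
      pow_nonneg (norm_nonneg p) n]
  · simpa using (summable_geometric_of_lt_one (norm_nonneg _) hp).mul_left ‖a‖

lemma tendsto_qFactorial {Q : ℂ} (hQ : ‖Q‖ < 1) :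
    Tendsto (qFactorial Q) atTop (𝓝 (qProd Q Q)) := by
  refine ((hasProd_qProd Q hQ).tendsto_prod_nat).congr fun n ↦ ?_
  exact prod_congr rfl fun i _ ↦ by ring

lemma qFactorial_ne_zero {Q : ℂ} (hQ : ‖Q‖ < 1) (n : ℕ) : qFactorial Q n ≠ 0 := by
  refine prod_ne_zero_iff.mpr fun i _ h ↦ ?_
  have h1 : ‖Q ^ (i + 1)‖ = 1 := by rw [← sub_eq_zero.mp h, norm_one]
  rw [norm_pow] at h1
  exact (pow_lt_one₀ (norm_nonneg _) hQ i.succ_ne_zero).ne h1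

lemma exists_norm_gaussBinomial_le {Q : ℂ} (hQ : ‖Q‖ < 1) :
    ∃ C, 0 ≤ C ∧ ∀ N k, ‖gaussBinomial Q N k‖ ≤ C := by
  have hlim := tendsto_qFactorial hQ
  obtain ⟨C₁, h₁⟩ := (Metric.isBounded_range_of_tendsto _ hlim).exists_norm_le
  obtain ⟨C₂, h₂⟩ := (Metric.isBounded_range_of_tendsto _
    (hlim.inv₀ (qProd_ne_zero hQ hQ))).exists_norm_le
  replace h₁ : ∀ n, ‖qFactorial Q n‖ ≤ C₁ := fun n ↦ h₁ _ ⟨n, rfl⟩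
  replace h₂ : ∀ n, ‖(qFactorial Q n)⁻¹‖ ≤ C₂ := fun n ↦ h₂ _ ⟨n, rfl⟩
  have h₁0 := (norm_nonneg _).trans (h₁ 0)
  have h₂0 := (norm_nonneg _).trans (h₂ 0)
  refine ⟨C₁ * (C₂ * C₂), by positivity, fun N k ↦ ?_⟩
  rcases lt_or_ge N k with h | h
  · rw [gaussBinomial_eq_zero Q h, norm_zero]; positivity
  obtain ⟨b, rfl⟩ := Nat.exists_eq_add_of_le h
  have h3 : gaussBinomial Q (k + b) k =
      qFactorial Q (k + b) * ((qFactorial Q k)⁻¹ * (qFactorial Q b)⁻¹) := by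
    rw [← gaussBinomial_mul_qFactorial]
    have := qFactorial_ne_zero hQ k
    have := qFactorial_ne_zero hQ b
    field_simp
  rw [h3, norm_mul, norm_mul]
  gcongr <;> apply_assumption

lemma summable_thetaTerm_natCast {z Q : ℂ} (hz : z ≠ 0) (hQ0 : Q ≠ 0) (hQ : ‖Q‖ < 1) :
    Summable fun n : ℕ ↦ thetaTerm z Q n := by
  have hne : ∀ n : ℕ, thetaTerm z Q n ≠ 0 := fun n ↦
    mul_ne_zero (zpow_ne_zero _ hz) (zpow_ne_zero _ hQ0)
  refine summable_of_ratio_test_tendsto_lt_one zero_lt_one (.of_forall hne) ?_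
  have h : ∀ n : ℕ, ‖thetaTerm z Q (n + 1 : ℕ)‖ / ‖thetaTerm z Q n‖ = ‖z‖ * ‖Q‖ ^ n := fun n ↦ by
    have h1 : thetaTerm z Q (n + 1 : ℕ) = thetaTerm z Q n * (z * Q ^ n) := by
      have h2 : ((n + 1 : ℕ) : ℤ) * ((n + 1 : ℕ) - 1) / 2 = (n : ℤ) * (n - 1) / 2 + n := by
        have h3 := two_mul_triangle (n + 1 : ℕ)
        have h4 := two_mul_triangle n
        push_cast at *
        linarith
      rw [thetaTerm, thetaTerm, h2, Nat.cast_succ, zpow_add₀ hz, zpow_add₀ hQ0, zpow_natCast,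
        zpow_natCast, zpow_one]
      ring
    rw [h1, norm_mul, mul_div_cancel_left₀ _ (norm_ne_zero_iff.mpr (hne n)), norm_mul, norm_pow]
  simp_rw [h]
  simpa using (tendsto_pow_atTop_nhds_zero_of_lt_one (norm_nonneg Q) hQ).const_mul ‖z‖

lemma summable_thetaTerm {z Q : ℂ} (hz : z ≠ 0) (hQ0 : Q ≠ 0) (hQ : ‖Q‖ < 1) :
    Summable (thetaTerm z Q) := by
  refine Summable.of_nat_of_neg (summable_thetaTerm_natCast hz hQ0 hQ)
    ((summable_thetaTerm_natCast (mul_ne_zero (inv_ne_zero hz) hQ0) hQ0 hQ).congr fun n ↦ ?_)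
  have h : (-n : ℤ) * (-n - 1) / 2 = (n : ℤ) * (n - 1) / 2 + n := by
    linarith [two_mul_triangle (-n), two_mul_triangle n]
  rw [thetaTerm, thetaTerm, h, zpow_add₀ hQ0, mul_zpow, inv_zpow, zpow_neg]
  ring

/-- The Jacobi triple product identity. -/
lemma hasSum_thetaTerm {z Q : ℂ} (hz : z ≠ 0) (hQ0 : Q ≠ 0) (hQ : ‖Q‖ < 1) :
    HasSum (thetaTerm z Q) (qProd Q Q * (qProd (-z) Q * qProd (-(z⁻¹ * Q)) Q)) := by
  have hsum := summable_thetaTerm hz hQ0 hQ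
  have hP := qProd_ne_zero hQ hQ
  obtain ⟨C, hC, hbound⟩ := exists_norm_gaussBinomial_le hQ
  let f : ℕ → ℤ → ℂ := fun n k ↦
    if -(n : ℤ) ≤ k then gaussBinomial Q (2 * n) (n + k).toNat * thetaTerm z Q k else 0
  have hf : ∀ n, ∑' k, f n k =
      (∏ j ∈ range n, (1 - -z * Q ^ j)) * ∏ j ∈ range n, (1 - -(z⁻¹ * Q) * Q ^ j) := fun n ↦ by
    have hinj : Function.Injective fun m : ℕ ↦ (m : ℤ) - n := fun a b h ↦ by simpa using h
    have h : HasSum (f n ∘ fun m : ℕ ↦ (m : ℤ) - n)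
        (∑ m ∈ range (2 * n + 1), (f n ∘ fun m : ℕ ↦ (m : ℤ) - n) m) := by
      refine hasSum_sum_of_ne_finset_zero fun m hm ↦ ?_
      have : 2 * n < m := by simpa [Nat.lt_succ_iff] using hm
      simp [f, gaussBinomial_eq_zero Q this]
    rw [hinj.hasSum_iff] at h
    · rw [h.tsum_eq]
      have h2 := prod_mul_prod_eq_sum_thetaTerm hz hQ0 n
      simp only [f, Function.comp_apply]
      convert h2.symm using 2
      · simp
      · exact prod_congr rfl fun j _ ↦ by ring
      · exact prod_congr rfl fun j _ ↦ by ring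
    · intro k hk
      refine if_neg fun h ↦ hk ⟨(n + k).toNat, ?_⟩
      simp only
      omega
  have hlim : Tendsto (fun n ↦ ∑' k, f n k) atTop
      (𝓝 (∑' k, (qProd Q Q)⁻¹ * thetaTerm z Q k)) := by
    refine tendsto_tsum_of_dominated_convergence (hsum.norm.mul_left C) (fun k ↦ ?_)
      (.of_forall fun n k ↦ ?_)
    · have hF := tendsto_qFactorial hQ
      have hcast : Tendsto (fun n : ℕ ↦ (n : ℤ)) atTop atTop := tendsto_natCast_atTop_atTop
      have htoNat : Tendsto Int.toNat atTop atTop :=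
        tendsto_atTop.mpr fun b ↦ by
          filter_upwards [eventually_ge_atTop (b : ℤ)] with a ha
          omega
      have h1 := hF.comp (htoNat.comp (tendsto_atTop_add_const_right _ k hcast))
      have h2 := hF.comp (htoNat.comp (tendsto_atTop_add_const_right _ (-k) hcast))
      have h3 := hF.comp (tendsto_id.const_mul_atTop' (two_pos : 0 < 2))
      have h4 := (h3.mul ((h1.mul h2).inv₀ (mul_ne_zero hP hP))).mul_const (thetaTerm z Q k)
      rw [show qProd Q Q * (qProd Q Q * qProd Q Q)⁻¹ = (qProd Q Q)⁻¹ by field_simp] at h4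
      refine h4.congr' ?_
      filter_upwards [eventually_ge_atTop k.natAbs] with n hn
      simp only [f, Function.comp_apply, id]
      rw [if_pos (by omega), show 2 * n = (n + k).toNat + (n + -k).toNat by omega,
        ← gaussBinomial_mul_qFactorial]
      have := qFactorial_ne_zero hQ (n + k).toNat
      have := qFactorial_ne_zero hQ (n + -k).toNat
      field_simp
    · simp only [f]
      split_ifs
      · rw [norm_mul]
        gcongr
        exact hbound _ _
      · rw [norm_zero]; positivity
  simp_rw [hf] at hlim
  have h := tendsto_nhds_unique hlim ((hasProd_qProd (-z) hQ).tendsto_prod_nat.mul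
    (hasProd_qProd (-(z⁻¹ * Q)) hQ).tendsto_prod_nat)
  rw [tsum_mul_left] at h
  rw [← h, mul_inv_cancel_left₀ hP]
  exact hsum.hasSum

lemma thetaTerm_two_mul (z : ℂ) {Q : ℂ} (hQ : Q ≠ 0) (m : ℤ) :
    thetaTerm z Q (2 * m) = thetaTerm (z ^ 2 * Q) (Q ^ 4) m := by
  have h : 2 * m * (2 * m - 1) / 2 = m + 4 * (m * (m - 1) / 2) := by
    linarith [two_mul_triangle (2 * m), two_mul_triangle m]
  rw [thetaTerm, thetaTerm, h, zpow_add₀ hQ, mul_zpow, zpow_mul, zpow_mul]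
  norm_cast
  ring

lemma thetaTerm_two_mul_add_one {z Q : ℂ} (hz : z ≠ 0) (hQ : Q ≠ 0) (m : ℤ) :
    thetaTerm z Q (2 * m + 1) = z * thetaTerm (z ^ 2 * Q ^ 3) (Q ^ 4) m := by
  have h : (2 * m + 1) * (2 * m + 1 - 1) / 2 = 3 * m + 4 * (m * (m - 1) / 2) := by
    linarith [two_mul_triangle (2 * m + 1), two_mul_triangle m]
  rw [thetaTerm, thetaTerm, h, zpow_add₀ hQ, zpow_add₀ hz, mul_zpow, zpow_mul, zpow_mul, zpow_mul]
  norm_cast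
  ring

/-- The 2-dissection of the triple product. -/
lemma qProd_dissection {z Q : ℂ} (hz : z ≠ 0) (hQ0 : Q ≠ 0) (hQ : ‖Q‖ < 1) :
    qProd Q Q * (qProd (-z) Q * qProd (-(z⁻¹ * Q)) Q) =
      qProd (Q ^ 4) (Q ^ 4) *
        (qProd (-(z ^ 2 * Q)) (Q ^ 4) * qProd (-((z ^ 2 * Q)⁻¹ * Q ^ 4)) (Q ^ 4)) +
      z * (qProd (Q ^ 4) (Q ^ 4) *
        (qProd (-(z ^ 2 * Q ^ 3)) (Q ^ 4) * qProd (-((z ^ 2 * Q ^ 3)⁻¹ * Q ^ 4)) (Q ^ 4))) := by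
  have hQ4 : ‖Q ^ 4‖ < 1 := by
    rw [norm_pow]; exact pow_lt_one₀ (norm_nonneg _) hQ four_ne_zero
  have he := hasSum_thetaTerm (z := z ^ 2 * Q) (by positivity) (pow_ne_zero 4 hQ0) hQ4
  have ho := (hasSum_thetaTerm (z := z ^ 2 * Q ^ 3) (by positivity)
    (pow_ne_zero 4 hQ0) hQ4).mul_left z
  replace he : HasSum (fun m : ℤ ↦ thetaTerm z Q (2 * m)) _ :=
    he.congr_fun (thetaTerm_two_mul z hQ0)
  simp_rw [← thetaTerm_two_mul_add_one hz hQ0] at ho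
  have hinje : Function.Injective fun m : ℤ ↦ 2 * m := fun a b h ↦ by simpa using h
  have hinjo : Function.Injective fun m : ℤ ↦ 2 * m + 1 := fun a b h ↦ by simpa using h
  have hcompl : IsCompl (Set.range fun m : ℤ ↦ 2 * m) (Set.range fun m : ℤ ↦ 2 * m + 1) := by
    have h1 : (Set.range fun m : ℤ ↦ 2 * m) = {k | Even k} := by
      ext k
      simp only [Set.mem_range, Set.mem_ofPred_eq, even_iff_exists_two_mul, eq_comm]
    have h2 : (Set.range fun m : ℤ ↦ 2 * m + 1) = {k | Odd k} := by
      ext k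
      simp only [Set.mem_range, Set.mem_ofPred_eq, Odd, eq_comm]
    rw [h1, h2]
    exact Int.isCompl_even_odd
  exact (hasSum_thetaTerm hz hQ0 hQ).unique
    (((hinje.hasSum_range_iff (f := thetaTerm z Q)).2 he).add_isCompl hcompl
      ((hinjo.hasSum_range_iff (f := thetaTerm z Q)).2 ho))

lemma qProd_eq_mul (a : ℂ) {p : ℂ} (hp : ‖p‖ < 1) :
    qProd a p = qProd a (p ^ 2) * qProd (a * p) (p ^ 2) := by
  have hp2 : ‖p ^ 2‖ < 1 := by
    rw [norm_pow]; exact pow_lt_one₀ (norm_nonneg _) hp two_ne_zero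
  have he : HasProd (fun n : ℕ ↦ 1 - a * p ^ (2 * n)) (qProd a (p ^ 2)) := by
    simpa only [pow_mul] using hasProd_qProd a hp2
  have ho : HasProd (fun n : ℕ ↦ 1 - a * p ^ (2 * n + 1)) (qProd (a * p) (p ^ 2)) := by
    simpa only [pow_succ', pow_mul, mul_assoc, pow_zero, mul_one] using hasProd_qProd (a * p) hp2
  exact (hasProd_qProd a hp).unique (HasProd.even_mul_odd he ho)

lemma qProd_mul_qProd_neg (a : ℂ) {p : ℂ} (hp : ‖p‖ < 1) :
    qProd a p * qProd (-a) p = qProd (a ^ 2) (p ^ 2) := by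
  have hp2 : ‖p ^ 2‖ < 1 := by
    rw [norm_pow]; exact pow_lt_one₀ (norm_nonneg _) hp two_ne_zero
  refine ((hasProd_qProd a hp).mul (hasProd_qProd (-a) hp)).unique ?_
  convert hasProd_qProd (a ^ 2) hp2 using 2
  ring

/-- The factors of residue `r` modulo `8` multiply to a `qProd`. -/
lemma hasProd_residue_eight {q : ℂ} (hq : ‖q‖ < 1) {r : ℕ} (hr : 0 < r) {ε : ℤ}
    (hε : ε = 1 ∨ ε = -1) :
    HasProd (fun j : ℕ ↦ (1 - q ^ (8 * j + r)) ^ ε) (qProd (q ^ r) (q ^ 8) ^ ε) := by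
  have hpow : ∀ n : ℕ, 0 < n → ‖q ^ n‖ < 1 := fun n hn ↦ by
    rw [norm_pow]; exact pow_lt_one₀ (norm_nonneg _) hq hn.ne'
  have h : HasProd (fun j : ℕ ↦ 1 - q ^ (8 * j + r)) (qProd (q ^ r) (q ^ 8)) := by
    convert hasProd_qProd (q ^ r) (hpow 8 (by norm_num)) using 3
    ring
  rcases hε with rfl | rfl
  · simpa using h
  · simpa using h.inv₀ (qProd_ne_zero (hpow r hr) (hpow 8 (by norm_num)))

lemma hasProd_chi8 {q : ℂ} (hq : ‖q‖ < 1) :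
    HasProd (fun n : ℕ ↦ (1 - q ^ (n + 1)) ^ chi8 (n + 1))
      (qProd (q ^ 1) (q ^ 8) * qProd (q ^ 7) (q ^ 8) /
        (qProd (q ^ 3) (q ^ 8) * qProd (q ^ 5) (q ^ 8))) := by
  have h : ∀ (r : ℕ) (ε : ℤ), 0 < r → (ε = 1 ∨ ε = -1) → (∀ j, chi8 (8 * j + r) = ε) →
      HasProd (fun j : ℕ ↦ (1 - q ^ (8 * j + r)) ^ chi8 (8 * j + r))
        (qProd (q ^ r) (q ^ 8) ^ ε) := fun r ε hr hε hc ↦ by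
    simp_rw [hc]
    exact hasProd_residue_eight hq hr hε
  have h1 := h 1 1 (by norm_num) (.inl rfl) fun j ↦ by unfold chi8; grind
  have h3 := h 3 (-1) (by norm_num) (.inr rfl) fun j ↦ by unfold chi8; grind
  have h5 := h 5 (-1) (by norm_num) (.inr rfl) fun j ↦ by unfold chi8; grind
  have h7 := h 7 1 (by norm_num) (.inl rfl) fun j ↦ by unfold chi8; grind
  have hodd : HasProd (fun k : ℕ ↦ (1 - q ^ (2 * k + 1 + 1)) ^ chi8 (2 * k + 1 + 1)) 1 := by
    have hc : ∀ k, chi8 (2 * k + 1 + 1) = 0 := fun k ↦ by unfold chi8; grind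
    simp_rw [hc, zpow_zero]
    exact hasProd_one
  have heven : HasProd (fun k : ℕ ↦ (1 - q ^ (2 * k + 1)) ^ chi8 (2 * k + 1))
      (qProd (q ^ 1) (q ^ 8) ^ (1 : ℤ) * qProd (q ^ 5) (q ^ 8) ^ (-1 : ℤ) *
        (qProd (q ^ 3) (q ^ 8) ^ (-1 : ℤ) * qProd (q ^ 7) (q ^ 8) ^ (1 : ℤ))) := by
    refine HasProd.even_mul_odd (HasProd.even_mul_odd ?_ ?_) (HasProd.even_mul_odd ?_ ?_)
    · exact h1.congr_fun fun j ↦ by ring_nf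
    · exact h5.congr_fun fun j ↦ by ring_nf
    · exact h3.congr_fun fun j ↦ by ring_nf
    · exact h7.congr_fun fun j ↦ by ring_nf
  convert HasProd.even_mul_odd (f := fun n : ℕ ↦ (1 - q ^ (n + 1)) ^ chi8 (n + 1)) heven hodd
    using 1
  simp only [zpow_one, zpow_neg, div_eq_mul_inv, mul_inv]
  ring

lemma qpow_eq_pow_s5 {τ σ : ℂ} {r : ℝ} {n : ℕ} (h : 2 * (r : ℂ) * σ = n * τ) :
    qpow σ r = qpow τ (1 / 2) ^ n := by
  rw [qpow, qpow, ← Complex.exp_nat_mul]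
  congr 1
  push_cast
  linear_combination (Real.pi : ℂ) * Complex.I * h

lemma norm_qpow_half_lt_one {τ : ℂ} (hτ : 0 < τ.im) : ‖qpow τ (1 / 2)‖ < 1 := by
  rw [qpow, Complex.norm_exp, Real.exp_lt_one_iff]
  simp
  positivity

lemma vRam_eq_s5 {τ s : ℂ} (hs : s = qpow τ (1 / 2)) (hs1 : ‖s‖ < 1) :
    vRam τ = s * (qProd (s ^ 2) (s ^ 16) * qProd (s ^ 14) (s ^ 16) /
      (qProd (s ^ 6) (s ^ 16) * qProd (s ^ 10) (s ^ 16))) := by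
  have hq : ‖s ^ 2‖ < 1 := by
    rw [norm_pow]; exact pow_lt_one₀ (norm_nonneg _) hs1 two_ne_zero
  have h : ∀ n : ℕ, qpow τ ((n : ℝ) + 1) = (s ^ 2) ^ (n + 1) := fun n ↦ by
    rw [hs, ← pow_mul]
    exact qpow_eq_pow_s5 (by push_cast; ring)
  have h1 := (hasProd_chi8 hq).tprod_eq
  simp only [← pow_mul] at h1 h
  norm_num only at h1
  rw [vRam, ← hs]
  simp_rw [h]
  rw [h1]

lemma pWeb_eq {τ s : ℂ} (hs : s = qpow τ (1 / 2)) (hs1 : ‖s‖ < 1) :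
    pWeb (8 * τ) = 2 * s * (qProd (-s ^ 8) (s ^ 8) / qProd (-s ^ 4) (s ^ 8)) ^ 2 := by
  have hpow : ∀ n : ℕ, 0 < n → ‖s ^ n‖ < 1 := fun n hn ↦ by
    rw [norm_pow]; exact pow_lt_one₀ (norm_nonneg _) hs1 hn.ne'
  have h1 : qpow (8 * τ) (1 / 16) = s := by
    rw [hs, ← pow_one (qpow τ _)]
    exact qpow_eq_pow_s5 (by push_cast; ring)
  have h2 : ∀ n : ℕ, qpow (8 * τ) (((n : ℝ) + 1) / 2) = s ^ 8 * (s ^ 8) ^ n := fun n ↦ by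
    rw [hs, ← pow_mul, ← pow_add]
    exact qpow_eq_pow_s5 (by push_cast; ring)
  have h3 : ∀ n : ℕ, qpow (8 * τ) (((n : ℝ) + 1) / 2 - 1 / 4) = s ^ 4 * (s ^ 8) ^ n := fun n ↦ by
    rw [hs, ← pow_mul, ← pow_add]
    exact qpow_eq_pow_s5 (by push_cast; ring)
  have h8 := hpow 8 (by norm_num)
  have h := (hasProd_qProd (-s ^ 8) h8).div₀ (hasProd_qProd (-s ^ 4) h8)
    (qProd_ne_zero (by rw [norm_neg]; exact hpow 4 (by norm_num)) h8)
  rw [pWeb, h1]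
  simp_rw [h2, h3]
  rw [sq (qProd _ _ / _), ← (h.mul h).tprod_eq]
  congr 2
  ext n
  ring

/-- The `q`-product identity underlying `1/v - v = φ(q²) / (q^{1/2} ψ(q⁴))`, with `q = s²`. -/
lemma qProd_sq_sub_sq {s : ℂ} (hs0 : s ≠ 0) (hs1 : ‖s‖ < 1) :
    qProd (-s ^ 8) (s ^ 8) ^ 2 * ((qProd (s ^ 6) (s ^ 16) * qProd (s ^ 10) (s ^ 16)) ^ 2 -
        s ^ 2 * (qProd (s ^ 2) (s ^ 16) * qProd (s ^ 14) (s ^ 16)) ^ 2) =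
      qProd (-s ^ 4) (s ^ 8) ^ 2 * ((qProd (s ^ 2) (s ^ 16) * qProd (s ^ 14) (s ^ 16)) *
        (qProd (s ^ 6) (s ^ 16) * qProd (s ^ 10) (s ^ 16))) := by
  have hpow : ∀ n : ℕ, 0 < n → ‖s ^ n‖ < 1 := fun n hn ↦ by
    rw [norm_pow]; exact pow_lt_one₀ (norm_nonneg _) hs1 hn.ne'
  have h8 := hpow 8 (by norm_num)
  have hQ0 : -s ^ 4 ≠ 0 := neg_ne_zero.mpr (pow_ne_zero 4 hs0)
  have hQ : ‖-s ^ 4‖ < 1 := by rw [norm_neg]; exact hpow 4 (by norm_num)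
  have hdis : ∀ z : ℂ, z ^ 2 = s ^ 2 →
      qProd (-s ^ 4) (-s ^ 4) * (qProd (-z) (-s ^ 4) * qProd (z * s ^ 2) (-s ^ 4)) =
        qProd (s ^ 16) (s ^ 16) * ((qProd (s ^ 6) (s ^ 16) * qProd (s ^ 10) (s ^ 16)) +
          z * (qProd (s ^ 2) (s ^ 16) * qProd (s ^ 14) (s ^ 16))) := fun z hz ↦ by
    have hz0 : z ≠ 0 := fun h ↦
      pow_ne_zero 2 hs0 (by rw [← hz, h, zero_pow two_ne_zero])
    have h := qProd_dissection hz0 hQ0 hQ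
    have e1 : -(z⁻¹ * -s ^ 4) = z * s ^ 2 := by
      field_simp
      rw [hz]
    have e2 : (-s ^ 4) ^ 4 = s ^ 16 := by ring
    have e3 : -(z ^ 2 * -s ^ 4) = s ^ 6 := by rw [hz]; ring
    have e4 : -((z ^ 2 * -s ^ 4)⁻¹ * s ^ 16) = s ^ 10 := by rw [hz]; field_simp
    have e5 : -(z ^ 2 * (-s ^ 4) ^ 3) = s ^ 14 := by rw [hz]; ring
    have e6 : -((z ^ 2 * (-s ^ 4) ^ 3)⁻¹ * s ^ 16) = s ^ 2 := by
      rw [hz]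
      field_simp
    rw [e1, e2, e3, e4, e5, e6] at h
    rw [h]
    ring
  have hplus := hdis s rfl
  have hminus := hdis (-s) (neg_sq s)
  have hsplit : qProd (-s ^ 4) (-s ^ 4) = qProd (-s ^ 4) (s ^ 8) * qProd (s ^ 8) (s ^ 8) := by
    convert qProd_eq_mul (-s ^ 4) hQ using 3 <;> ring
  have hdouble : qProd (s ^ 8) (s ^ 8) * qProd (-s ^ 8) (s ^ 8) = qProd (s ^ 16) (s ^ 16) := by
    convert qProd_mul_qProd_neg (s ^ 8) h8 using 2 <;> ring
  have hs : qProd s (-s ^ 4) * qProd (-s) (-s ^ 4) =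
      qProd (s ^ 2) (s ^ 16) * qProd (s ^ 10) (s ^ 16) := by
    rw [qProd_mul_qProd_neg s hQ, show (-s ^ 4) ^ 2 = s ^ 8 by ring, qProd_eq_mul _ h8]
    congr 2 <;> ring
  have hs3 : qProd (s * s ^ 2) (-s ^ 4) * qProd (-s * s ^ 2) (-s ^ 4) =
      qProd (s ^ 6) (s ^ 16) * qProd (s ^ 14) (s ^ 16) := by
    rw [neg_mul, qProd_mul_qProd_neg _ hQ, show (-s ^ 4) ^ 2 = s ^ 8 by ring, qProd_eq_mul _ h8]
    congr 2 <;> ring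
  have hE := qProd_ne_zero h8 h8
  rw [neg_neg] at hminus
  rw [hsplit, ← hdouble] at hplus hminus
  refine mul_left_cancel₀ (pow_ne_zero 2 hE) ?_
  generalize qProd (s ^ 8) (s ^ 8) = E at *
  generalize qProd (-s ^ 8) (s ^ 8) = D at *
  generalize qProd (-s ^ 4) (s ^ 8) = C at *
  generalize qProd (s ^ 2) (s ^ 16) = A at *
  generalize qProd (s ^ 14) (s ^ 16) = A' at *
  generalize qProd (s ^ 6) (s ^ 16) = B at *
  generalize qProd (s ^ 10) (s ^ 16) = B' at *
  have h := congr_arg₂ (· * ·) hplus hminus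
  have hss := congr_arg₂ (· * ·) hs hs3
  linear_combination -h + (C * E) ^ 2 * hss

/-- If `τ` lies in the upper half-plane, then `2v(τ) = 𝔭(8τ)(1 - v(τ)²)`. -/
theorem v_p_relation (τ : ℂ) (hτ : 0 < τ.im) :
    2 * vRam τ = pWeb (8 * τ) * (1 - vRam τ ^ 2) := by
  have hs1 := norm_qpow_half_lt_one hτ
  have hs0 : qpow τ (1 / 2) ≠ 0 := Complex.exp_ne_zero _
  rw [vRam_eq_s5 rfl hs1, pWeb_eq rfl hs1]
  generalize qpow τ (1 / 2) = s at *
  have hpow : ∀ n : ℕ, 0 < n → ‖s ^ n‖ < 1 := fun n hn ↦ by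
    rw [norm_pow]; exact pow_lt_one₀ (norm_nonneg _) hs1 hn.ne'
  have h := qProd_sq_sub_sq hs0 hs1
  have hC : qProd (-s ^ 4) (s ^ 8) ≠ 0 :=
    qProd_ne_zero (by rw [norm_neg]; exact hpow 4 (by norm_num)) (hpow 8 (by norm_num))
  have hB : qProd (s ^ 6) (s ^ 16) ≠ 0 :=
    qProd_ne_zero (hpow 6 (by norm_num)) (hpow 16 (by norm_num))
  have hB' : qProd (s ^ 10) (s ^ 16) ≠ 0 :=
    qProd_ne_zero (hpow 10 (by norm_num)) (hpow 16 (by norm_num))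
  field_simp
  linear_combination -h
end
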